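/- arXiv:1412.5912 — 9 statements merged into one kernel-verified Lean document; each statement's English description precedes it below -/
import Mathlib

section
/- Let R be a commutative Noetherian local ring, M a Cohen-Macaulay finitely generated R-module of dimension d, and let 𝔟 ⊆ 𝔞 be parameter ideals of M. Then Hom_R(R/𝔞, M/𝔟M) is isomorphic as an R-module to M/𝔞M. -/
/-- The `I`-power-torsion submodule `Γ_I(M) = {x ∈ M | I^k x = 0 for some k}`,
i.e. the zeroth local cohomology of `M` with support in `I`. -/
def torsionGamma {R : Type*} [CommRing R] (I : Ideal R) (M : Type*) [AddCommGroup M]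
    [Module R M] : Submodule R M where
  carrier := {x | ∃ k : ℕ, ∀ r ∈ I ^ k, r • x = (0 : M)}
  zero_mem' := ⟨0, fun r _ => smul_zero r⟩
  add_mem' := by
    rintro x y ⟨k, hk⟩ ⟨l, hl⟩
    refine ⟨k + l, fun r hr => ?_⟩
    have hrk : r ∈ I ^ k := Ideal.pow_le_pow_right (Nat.le_add_right k l) hr
    have hrl : r ∈ I ^ l := Ideal.pow_le_pow_right (Nat.le_add_left l k) hr
    rw [smul_add, hk r hrk, hl r hrl, add_zero]
  smul_mem' := by
    rintro c x ⟨k, hk⟩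
    refine ⟨k, fun r hr => ?_⟩
    rw [smul_smul, mul_comm, ← smul_smul, hk r hr, smul_zero]

/-- The depth of a module: the supremum of the lengths of regular sequences on `M`
consisting of nonunits (for a local ring, elements of the maximal ideal). -/
noncomputable def moduleDepth (R M : Type*) [CommRing R] [AddCommGroup M] [Module R M] : ℕ∞ :=
  sSup {n : ℕ∞ | ∃ rs : List R, (rs.length : ℕ∞) = n ∧ (∀ r ∈ rs, r ∈ nonunits R) ∧
    RingTheory.Sequence.IsRegular M rs}

/-- The (Krull) dimension of a module: the Krull dimension of `R / ann M`. -/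
noncomputable def moduleDim (R M : Type*) [CommRing R] [AddCommGroup M] [Module R M] :
    WithBot ℕ∞ :=
  ringKrullDim (R ⧸ Module.annihilator R M)

/-- A module is Cohen-Macaulay if its depth equals its dimension. -/
def IsCohenMacaulay (R M : Type*) [CommRing R] [AddCommGroup M] [Module R M] : Prop :=
  (moduleDepth R M : WithBot ℕ∞) = moduleDim R M

/-- `a : Fin d → R` is a system of parameters of `M` if `M` has dimension `d`, the `a i`
are nonunits (i.e. lie in the maximal ideal, when `R` is local), and `M/(a)M` has
finite length. -/
def IsSystemOfParameters (R M : Type*) [CommRing R] [AddCommGroup M] [Module R M]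
    {d : ℕ} (a : Fin d → R) : Prop :=
  (∀ i, a i ∈ nonunits R) ∧ moduleDim R M = (d : ℕ∞) ∧
    IsFiniteLength R (M ⧸ (Ideal.span (Set.range a) • (⊤ : Submodule R M)))

/-- An ideal is a parameter ideal of `M` if it is generated by a system of parameters of `M`. -/
def IsParameterIdeal (R M : Type*) [CommRing R] [AddCommGroup M] [Module R M]
    (I : Ideal R) : Prop :=
  ∃ (d : ℕ) (a : Fin d → R), IsSystemOfParameters R M a ∧ I = Ideal.span (Set.range a)

/-- A parameter of a one-dimensional module `M`: a nonunit `a` (i.e. an element of the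
maximal ideal, when `R` is local) such that `M/aM` has finite length. -/
def IsParameter (R M : Type*) [CommRing R] [AddCommGroup M] [Module R M] (a : R) : Prop :=
  a ∈ nonunits R ∧ IsFiniteLength R (M ⧸ (Ideal.span {a} • (⊤ : Submodule R M)))

/-- A module is decomposable if it is the (internal, equivalently external) direct sum of
two nonzero submodules. -/
def IsDecomposable (R M : Type*) [Ring R] [AddCommGroup M] [Module R M] : Prop :=
  ∃ X Y : Submodule R M, X ≠ ⊥ ∧ Y ≠ ⊥ ∧ IsCompl X Y

theorem homIsTorsion {R : Type*} [CommRing R] (I : Ideal R) (N : Type*) [AddCommGroup N]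
    [Module R N] : Module.IsTorsionBySet R ((R ⧸ I) →ₗ[R] N) I := by
  intro φ a
  refine LinearMap.ext fun x => ?_
  obtain ⟨r, rfl⟩ := Ideal.Quotient.mk_surjective x
  have hx : (a : R) • (Ideal.Quotient.mk I r : R ⧸ I) = 0 := by
    have h1 : (a : R) • (Ideal.Quotient.mk I r : R ⧸ I) = Ideal.Quotient.mk I ((a : R) * r) :=
      rfl
    rw [h1, Ideal.Quotient.eq_zero_iff_mem]
    exact I.mul_mem_right r a.2
  calc ((a : R) • φ) (Ideal.Quotient.mk I r)
      = (a : R) • φ (Ideal.Quotient.mk I r) := rfl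
    _ = φ ((a : R) • (Ideal.Quotient.mk I r : R ⧸ I)) := (map_smul φ _ _).symm
    _ = 0 := by rw [hx, map_zero]

/-- The canonical `R ⧸ I`-module structure on `Hom_R(R ⧸ I, N)`. -/
noncomputable def quotHomModule {R : Type*} [CommRing R] (I : Ideal R) (N : Type*)
    [AddCommGroup N] [Module R N] : Module (R ⧸ I) ((R ⧸ I) →ₗ[R] N) :=
  (homIsTorsion I N).module

open IsLocalRing

section Helpers

open RingTheory.Sequence Pointwise

theorem hq_isom_of_range {R Q A B : Type*} [CommRing R] [AddCommGroup Q] [Module R Q]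
    [AddCommGroup A] [Module R A] [AddCommGroup B] [Module R B] (f : A →ₗ[R] B)
    (hf : Function.Injective f) (h : ∀ (g : Q →ₗ[R] B) (q : Q), g q ∈ LinearMap.range f) :
    Nonempty ((Q →ₗ[R] A) ≃ₗ[R] (Q →ₗ[R] B)) := by
  refine ⟨LinearEquiv.ofBijective (LinearMap.llcomp R Q A B f) ⟨?_, ?_⟩⟩
  · intro g₁ g₂ hg
    ext q
    exact hf (LinearMap.congr_fun hg q)
  · intro g
    refine ⟨(LinearEquiv.ofInjective f hf).symm.toLinearMap ∘ₗ
      LinearMap.codRestrict (LinearMap.range f) g (h g), ?_⟩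
    ext q
    have := LinearEquiv.apply_symm_apply (LinearEquiv.ofInjective f hf) ⟨g q, h g q⟩
    exact congrArg Subtype.val this

theorem hq_isom_mul {R Q N : Type*} [CommRing R] [AddCommGroup Q] [Module R Q]
    [AddCommGroup N] [Module R N] (x y : R) (hx : x ∈ Module.annihilator R Q)
    (rx : IsSMulRegular N x) (ry : IsSMulRegular N y) :
    Nonempty ((Q →ₗ[R] QuotSMulTop x N) ≃ₗ[R] (Q →ₗ[R] QuotSMulTop (x * y) N)) := by
  have hle : (x • (⊤ : Submodule R N)) ≤
      Submodule.comap (LinearMap.lsmul R N y) ((x * y) • (⊤ : Submodule R N)) := by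
    intro n hn
    obtain ⟨m, -, rfl⟩ := (Submodule.mem_smul_pointwise_iff_exists _ _ _).1 hn
    refine (Submodule.mem_smul_pointwise_iff_exists _ _ _).2 ⟨m, trivial, ?_⟩
    simp [smul_smul, mul_comm]
  refine hq_isom_of_range (Submodule.mapQ _ _ (LinearMap.lsmul R N y) hle) ?_ ?_
  · rw [← LinearMap.ker_eq_bot, LinearMap.ker_eq_bot']
    intro n
    obtain ⟨n, rfl⟩ := Submodule.Quotient.mk_surjective _ n
    intro h
    rw [Submodule.mapQ_apply, Submodule.Quotient.mk_eq_zero] at h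
    obtain ⟨m, -, hm⟩ := (Submodule.mem_smul_pointwise_iff_exists _ _ _).1 h
    rw [Submodule.Quotient.mk_eq_zero]
    refine (Submodule.mem_smul_pointwise_iff_exists _ _ _).2 ⟨m, trivial, ?_⟩
    apply ry
    simpa [smul_smul, mul_comm] using hm
  · intro g q
    obtain ⟨n, hn⟩ := Submodule.Quotient.mk_surjective _ (g q)
    have h0 : x • g q = 0 := by
      rw [← map_smul, Module.mem_annihilator.1 hx q, map_zero]
    rw [← hn, ← Submodule.Quotient.mk_smul, Submodule.Quotient.mk_eq_zero] at h0
    obtain ⟨m, -, hm⟩ := (Submodule.mem_smul_pointwise_iff_exists _ _ _).1 h0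
    refine ⟨Submodule.Quotient.mk m, ?_⟩
    rw [Submodule.mapQ_apply, ← hn]
    congr 1
    apply rx
    simpa [smul_smul] using hm

theorem hq_isom_one {R Q N : Type*} [CommRing R] [AddCommGroup Q] [Module R Q]
    [AddCommGroup N] [Module R N] (x y : R) (hx : x ∈ Module.annihilator R Q)
    (hy : y ∈ Module.annihilator R Q)
    (rx : IsSMulRegular N x) (ry : IsSMulRegular N y) :
    Nonempty ((Q →ₗ[R] QuotSMulTop x N) ≃ₗ[R] (Q →ₗ[R] QuotSMulTop y N)) := by
  obtain ⟨e₁⟩ := hq_isom_mul (Q := Q) x y hx rx ry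
  obtain ⟨e₂⟩ := hq_isom_mul (Q := Q) y x hy ry rx
  rw [mul_comm] at e₂
  exact ⟨e₁ ≪≫ₗ e₂.symm⟩

theorem hq_exists_common {R Q N₁ N₂ : Type*} [CommRing R] [IsNoetherianRing R]
    [AddCommGroup Q] [Module R Q] [Module.Finite R Q]
    [AddCommGroup N₁] [Module R N₁] [Module.Finite R N₁]
    [AddCommGroup N₂] [Module R N₂] [Module.Finite R N₂]
    (h₁ : Subsingleton (Q →ₗ[R] N₁)) (h₂ : Subsingleton (Q →ₗ[R] N₂)) :
    ∃ z ∈ Module.annihilator R Q, IsSMulRegular N₁ z ∧ IsSMulRegular N₂ z := by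
  have : Subsingleton (Q →ₗ[R] (N₁ × N₂)) :=
    (LinearMap.prodEquiv (M := Q) (M₂ := N₁) (M₃ := N₂) R).symm.toEquiv.subsingleton
  obtain ⟨z, hz, rz⟩ := IsSMulRegular.subsingleton_linearMap_iff.1 this
  refine ⟨z, hz, fun a b hab => ?_, fun a b hab => ?_⟩
  · exact (Prod.ext_iff.1 (@rz (a, 0) (b, 0) (Prod.ext hab rfl))).1
  · exact (Prod.ext_iff.1 (@rz (0, a) (0, b) (Prod.ext rfl hab))).2

theorem hq_cons_iff {R M : Type*} [CommRing R] [IsNoetherianRing R] [IsLocalRing R]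
    [AddCommGroup M] [Module R M] [Module.Finite R M] (x : R) (xs : List R)
    (hx : x ∈ maximalIdeal R) (hxs : ∀ r ∈ xs, r ∈ maximalIdeal R) :
    IsWeaklyRegular M (x :: xs) ↔ IsWeaklyRegular M xs ∧
      IsSMulRegular (M ⧸ (Ideal.ofList xs • (⊤ : Submodule R M))) x := by
  have h1 : ∀ r ∈ x :: xs, r ∈ maximalIdeal R := by
    simpa using ⟨hx, hxs⟩
  have h2 : ∀ r ∈ xs ++ [x], r ∈ maximalIdeal R := by
    intro r hr
    apply h1
    simp at hr ⊢
    tauto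
  rw [← isWeaklyRegular_singleton_iff, ← isWeaklyRegular_append_iff]
  exact ⟨fun h => IsLocalRing.isWeaklyRegular_of_perm_of_subset_maximalIdeal h
      (List.perm_append_singleton x xs).symm h1,
    fun h => IsLocalRing.isWeaklyRegular_of_perm_of_subset_maximalIdeal h
      (List.perm_append_singleton x xs) h2⟩

theorem hq_rees {R Q : Type*} [CommRing R] [IsNoetherianRing R] [IsLocalRing R]
    [AddCommGroup Q] [Module R Q] [Module.Finite R Q]
    (hQ : Module.annihilator R Q ≤ maximalIdeal R) (xs : List R) :
    ∀ {M : Type*} [AddCommGroup M] [Module R M] [Module.Finite R M] (ys : List R),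
    xs.length = ys.length → (∀ r ∈ xs, r ∈ Module.annihilator R Q) →
    (∀ r ∈ ys, r ∈ Module.annihilator R Q) → IsWeaklyRegular M xs → IsWeaklyRegular M ys →
    Nonempty ((Q →ₗ[R] (M ⧸ (Ideal.ofList xs • (⊤ : Submodule R M)))) ≃ₗ[R]
      (Q →ₗ[R] (M ⧸ (Ideal.ofList ys • (⊤ : Submodule R M))))) := by
  induction xs with
  | nil =>
    intro M _ _ _ ys hl _ _ _ _
    obtain rfl : ys = [] := List.eq_nil_of_length_eq_zero (by simpa using hl.symm)
    exact ⟨LinearEquiv.refl _ _⟩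
  | cons x xs ih =>
    intro M _ _ _ ys hl hxs hys rxs rys
    cases ys with
    | nil => simp at hl
    | cons y ys =>
      simp only [List.forall_mem_cons] at hxs hys
      obtain ⟨hx, hxs⟩ := hxs
      obtain ⟨hy, hys⟩ := hys
      obtain ⟨wx, rx⟩ := (hq_cons_iff x xs (hQ hx) (fun r hr => hQ (hxs r hr))).1 rxs
      obtain ⟨wy, ry⟩ := (hq_cons_iff y ys (hQ hy) (fun r hr => hQ (hys r hr))).1 rys
      obtain ⟨z, hz, zx, zy⟩ := hq_exists_common (Q := Q)
        (rx.linearMap_subsingleton_of_mem_annihilator hx)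
        (ry.linearMap_subsingleton_of_mem_annihilator hy)
      have zxs := (hq_cons_iff z xs (hQ hz) (fun r hr => hQ (hxs r hr))).2 ⟨wx, zx⟩
      have zys := (hq_cons_iff z ys (hQ hz) (fun r hr => hQ (hys r hr))).2 ⟨wy, zy⟩
      obtain ⟨e⟩ := ih (M := QuotSMulTop z M) ys (by simpa using hl) hxs hys
        ((isWeaklyRegular_cons_iff _ _ _).1 zxs).2 ((isWeaklyRegular_cons_iff _ _ _).1 zys).2
      obtain ⟨ex⟩ := hq_isom_one (Q := Q) x z hx hz rx zx
      obtain ⟨ey⟩ := hq_isom_one (Q := Q) y z hy hz ry zy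
      exact ⟨(Submodule.quotOfListConsSMulTopEquivQuotSMulTopOuter M x xs).congrRight ≪≫ₗ ex ≪≫ₗ
        (Submodule.quotOfListConsSMulTopEquivQuotSMulTopOuter M z xs).symm.congrRight ≪≫ₗ
        (Submodule.quotOfListConsSMulTopEquivQuotSMulTopInner M z xs).congrRight ≪≫ₗ e ≪≫ₗ
        (Submodule.quotOfListConsSMulTopEquivQuotSMulTopInner M z ys).symm.congrRight ≪≫ₗ
        (Submodule.quotOfListConsSMulTopEquivQuotSMulTopOuter M z ys).congrRight ≪≫ₗ ey.symm ≪≫ₗ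
        (Submodule.quotOfListConsSMulTopEquivQuotSMulTopOuter M y ys).symm.congrRight⟩

theorem hq_depth {R : Type*} [CommRing R] [IsNoetherianRing R] [IsLocalRing R] (n : ℕ) :
    ∀ {M : Type*} [AddCommGroup M] [Module R M] [Module.Finite R M] (x : R) (ys : List R),
    ys.length = n + 1 → x ∈ maximalIdeal R → (∀ r ∈ ys, r ∈ maximalIdeal R) →
    IsSMulRegular M x → IsWeaklyRegular M ys →
    ∃ ws : List R, ws.length = n ∧ (∀ r ∈ ws, r ∈ maximalIdeal R) ∧
      IsWeaklyRegular (QuotSMulTop x M) ws := by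
  induction n with
  | zero =>
    intro M _ _ _ x ys _ _ _ _ _
    exact ⟨[], rfl, by simp, .nil R _⟩
  | succ n ih =>
    intro M _ _ _ x ys hl hx hys rx rys
    match ys, hl with
    | y :: y₂ :: ys, hl =>
      have hann : Module.annihilator R (R ⧸ maximalIdeal R) = maximalIdeal R :=
        Ideal.annihilator_quotient
      simp only [List.forall_mem_cons] at hys
      obtain ⟨hy, hy₂, hys⟩ := hys
      have htl : ∀ r ∈ y₂ :: ys, r ∈ maximalIdeal R := by
        simpa using ⟨hy₂, hys⟩
      obtain ⟨wt, rt⟩ := (hq_cons_iff y (y₂ :: ys) hy htl).1 rys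
      obtain ⟨ry, rys'⟩ := (isWeaklyRegular_cons_iff _ _ _).1 rys
      obtain ⟨ry₂, -⟩ := (isWeaklyRegular_cons_iff _ _ _).1 rys'
      obtain ⟨e⟩ := hq_isom_one (Q := R ⧸ maximalIdeal R) x y
        (by rw [hann]; exact hx) (by rw [hann]; exact hy) rx ry
      have s₂ := ry₂.linearMap_subsingleton_of_mem_annihilator
        (N := R ⧸ maximalIdeal R) (hann.symm ▸ hy₂)
      have s₁ : Subsingleton ((R ⧸ maximalIdeal R) →ₗ[R] QuotSMulTop x M) :=
        e.toEquiv.subsingleton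
      obtain ⟨z, hz, z₁, z₂⟩ := hq_exists_common s₁
        (rt.linearMap_subsingleton_of_mem_annihilator (N := R ⧸ maximalIdeal R)
          (hann.symm ▸ hy))
      rw [hann] at hz
      have zt := (isWeaklyRegular_cons_iff _ _ _).1
        ((hq_cons_iff z (y₂ :: ys) hz htl).2 ⟨wt, z₂⟩)
      have xz : IsWeaklyRegular M [x, z] := by
        rw [isWeaklyRegular_cons_iff, isWeaklyRegular_singleton_iff]
        exact ⟨rx, z₁⟩
      have zx : IsWeaklyRegular M [z, x] :=
        IsLocalRing.isWeaklyRegular_of_perm_of_subset_maximalIdeal xz (List.Perm.swap _ _ _)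
          (by simpa using ⟨hx, hz⟩)
      rw [isWeaklyRegular_cons_iff, isWeaklyRegular_singleton_iff] at zx
      obtain ⟨ws, hwl, hws, rws⟩ := ih (M := QuotSMulTop z M) x (y₂ :: ys)
        (by simpa using hl) hx htl zx.2 zt.2
      have hfin : IsWeaklyRegular M (z :: x :: ws) := by
        rw [isWeaklyRegular_cons_iff, isWeaklyRegular_cons_iff]
        exact ⟨zx.1, zx.2, rws⟩
      have hfin' : IsWeaklyRegular M (x :: z :: ws) :=
        IsLocalRing.isWeaklyRegular_of_perm_of_subset_maximalIdeal hfin (List.Perm.swap _ _ _)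
          (by simpa using ⟨hz, hx, hws⟩)
      exact ⟨z :: ws, by simpa using hwl, by simpa using ⟨hz, hws⟩,
        ((isWeaklyRegular_cons_iff _ _ _).1 hfin').2⟩

theorem hq_ass {R : Type*} [CommRing R] [IsNoetherianRing R] [IsLocalRing R] (ys : List R) :
    ∀ {M : Type*} [AddCommGroup M] [Module R M] [Module.Finite R M],
    (∀ r ∈ ys, r ∈ maximalIdeal R) → IsWeaklyRegular M ys →
    ∀ p : PrimeSpectrum R, IsAssociatedPrime p.asIdeal M →
    (ys.length : ℕ∞) ≤ Order.coheight p := by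
  induction ys with
  | nil => intros; simp
  | cons y ys ih =>
    intro M _ _ _ hys rys p hp
    simp only [List.forall_mem_cons] at hys
    obtain ⟨hy, hys⟩ := hys
    obtain ⟨ry, rys⟩ := (isWeaklyRegular_cons_iff _ _ _).1 rys
    obtain ⟨-, x, hx⟩ := isAssociatedPrime_iff.1 hp
    have hyp : y ∉ p.asIdeal := by
      intro h
      have hx0 : x = 0 := by
        apply ry
        rw [hx] at h
        simpa using h
      apply p.2.ne_top
      rw [hx, hx0]
      ext; simp
    let K : Submodule R M := Submodule.torsionBySet R M p.asIdeal
    have hK : ∃ k ∈ K, k ∉ y • (⊤ : Submodule R M) := by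
      by_contra! hcon
      have hKy : K = y • K := by
        apply le_antisymm
        · intro k hk
          obtain ⟨m, -, rfl⟩ := (Submodule.mem_smul_pointwise_iff_exists _ _ _).1 (hcon k hk)
          refine (Submodule.mem_smul_pointwise_iff_exists _ _ _).2 ⟨m, ?_, rfl⟩
          rw [Submodule.mem_torsionBySet_iff] at hk ⊢
          intro a
          apply ry
          have := hk a
          simp only [smul_zero]
          rw [smul_comm]
          exact this
        · exact Submodule.smul_le_self_of_tower y K
      have hbot := Submodule.eq_bot_of_eq_pointwise_smul_of_mem_jacobson_annihilator
        (IsNoetherian.noetherian K) hKy (IsLocalRing.maximalIdeal_le_jacobson _ hy)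
      have hxK : x ∈ K := by
        rw [Submodule.mem_torsionBySet_iff]
        intro a
        have h1 : (a : R) ∈ (⊥ : Submodule R M).colon {x} := hx.le a.2
        simpa using h1
      rw [hbot, Submodule.mem_bot] at hxK
      apply p.2.ne_top
      rw [hx, hxK]
      ext; simp
    obtain ⟨k, hkK, hk⟩ := hK
    have hk0 : (Submodule.Quotient.mk k : QuotSMulTop y M) ≠ 0 := by
      rwa [Ne, Submodule.Quotient.mk_eq_zero]
    obtain ⟨q, hq, hle⟩ := exists_le_isAssociatedPrime_of_isNoetherianRing R _ hk0
    let q' : PrimeSpectrum R := ⟨q, hq.isPrime⟩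
    have h1 : (ys.length : ℕ∞) ≤ Order.coheight q' := ih hys rys q' hq
    have hpq : p < q' := by
      apply lt_of_le_of_ne
      · intro a ha
        apply hle
        have := (Submodule.mem_torsionBySet_iff _ _).1 hkK ⟨a, ha⟩
        simp only at this
        simp [← Submodule.Quotient.mk_smul, this]
      · intro h
        apply hyp
        rw [h]
        apply hle
        simp only [Submodule.mem_colon_singleton, Submodule.mem_bot]
        rw [← Submodule.Quotient.mk_smul, Submodule.Quotient.mk_eq_zero]
        exact Submodule.smul_mem_pointwise_smul _ _ _ trivial
    calc ((y :: ys).length : ℕ∞) = ys.length + 1 := by simp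
      _ ≤ Order.coheight q' + 1 := by gcongr
      _ ≤ Order.coheight p := Order.coheight_add_one_le hpq

theorem hq_dim_le {R : Type*} [CommRing R] [IsNoetherianRing R] [IsLocalRing R] (xs : List R) :
    ∀ {M : Type*} [AddCommGroup M] [Module R M] [Module.Finite R M],
    (∀ r ∈ xs, r ∈ maximalIdeal R) →
    Module.supportDim R M ≤
      Module.supportDim R (M ⧸ (Ideal.ofList xs • (⊤ : Submodule R M))) + xs.length := by
  induction xs with
  | nil =>
    intro M _ _ _ _
    rw [Ideal.ofList_nil, Submodule.bot_smul,
      Module.supportDim_eq_of_equiv (Submodule.quotEquivOfEqBot (⊥ : Submodule R M) rfl)]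
    simp
  | cons x xs ih =>
    intro M _ _ _ h
    simp only [List.forall_mem_cons] at h
    rw [Module.supportDim_eq_of_equiv
      (Submodule.quotOfListConsSMulTopEquivQuotSMulTopInner M x xs)]
    refine (Module.supportDim_le_supportDim_quotSMulTop_succ h.1).trans ?_
    grw [ih (M := QuotSMulTop x M) h.2]
    simp [add_assoc]

theorem hq_dim_zero {R P : Type*} [CommRing R] [IsNoetherianRing R] [IsLocalRing R]
    [AddCommGroup P] [Module R P] (h : IsFiniteLength R P) : Module.supportDim R P ≤ 0 := by
  obtain ⟨_, _⟩ := isFiniteLength_iff_isNoetherian_isArtinian.1 h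
  have key : ∀ p ∈ Module.support R P, p.asIdeal = maximalIdeal R := by
    intro p hp
    apply le_antisymm (IsLocalRing.le_maximalIdeal p.2.ne_top)
    intro x hx
    obtain ⟨n, hn⟩ := IsArtinian.range_smul_pow_stabilizes P x
    have h1 := hn (n + 1) (by omega)
    have hbot : LinearMap.range (x ^ n • LinearMap.id : P →ₗ[R] P) = ⊥ := by
      refine Submodule.eq_bot_of_eq_pointwise_smul_of_mem_jacobson_annihilator
        (IsNoetherian.noetherian _) (r := x) ?_ (IsLocalRing.maximalIdeal_le_jacobson _ hx)
      conv_lhs => rw [h1]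
      ext m
      rw [Submodule.mem_smul_pointwise_iff_exists]
      simp [pow_succ', mul_smul]
    have : x ^ n ∈ Module.annihilator R P := by
      rw [Module.mem_annihilator]
      intro m
      have : (x ^ n • LinearMap.id : P →ₗ[R] P) m ∈
        LinearMap.range (x ^ n • LinearMap.id : P →ₗ[R] P) := ⟨m, rfl⟩
      rw [hbot] at this
      simpa using this
    exact p.2.mem_of_pow_mem n (Module.mem_support_iff_of_finite.1 hp this)
  have : Subsingleton (Module.support R P) :=
    ⟨fun a b => Subtype.ext (PrimeSpectrum.ext ((key _ a.2).trans (key _ b.2).symm))⟩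
  exact Order.krullDim_nonpos_of_subsingleton

theorem hq_coheight_le {R N : Type*} [CommRing R] [AddCommGroup N] [Module R N]
    (p : PrimeSpectrum R) (hp : p ∈ Module.support R N) :
    (Order.coheight p : WithBot ℕ∞) ≤ Module.supportDim R N := by
  have : Order.coheight p ≤ Order.coheight (⟨p, hp⟩ : Module.support R N) := by
    apply Order.coheight_le
    intro s hs
    have hmem : ∀ i, s i ∈ Module.support R N := fun i =>
      Module.mem_support_mono (hs ▸ s.head_le i) hp
    let t : LTSeries (Module.support R N) :=
      { length := s.length
        toFun := fun i => ⟨s i, hmem i⟩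
        step := fun i => s.step i }
    have : t.length ≤ Order.coheight t.head := Order.length_le_coheight_head
    have ht : t.head = ⟨p, hp⟩ := Subtype.ext hs
    rwa [ht] at this
  exact (WithBot.coe_le_coe.2 this).trans (Order.coheight_le_krullDim _)

theorem hq_sop {R : Type*} [CommRing R] [IsNoetherianRing R] [IsLocalRing R] (xs : List R) :
    ∀ {M : Type*} [AddCommGroup M] [Module R M] [Module.Finite R M] (ys : List R),
    ys.length = xs.length → (∀ r ∈ xs, r ∈ maximalIdeal R) → (∀ r ∈ ys, r ∈ maximalIdeal R) →
    IsWeaklyRegular M ys →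
    Module.supportDim R (M ⧸ (Ideal.ofList xs • (⊤ : Submodule R M))) ≤ 0 →
    IsWeaklyRegular M xs := by
  induction xs with
  | nil => intros; exact .nil R _
  | cons x xs ih =>
    intro M _ _ _ ys hl hxs hys rys hdim
    simp only [List.forall_mem_cons] at hxs
    obtain ⟨hx, hxs⟩ := hxs
    rw [Module.supportDim_eq_of_equiv
      (Submodule.quotOfListConsSMulTopEquivQuotSMulTopInner M x xs)] at hdim
    have h1 : Module.supportDim R (QuotSMulTop x M) ≤ (xs.length : ℕ∞) := by
      refine (hq_dim_le xs hxs).trans ?_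
      grw [hdim]
      simp
    have rx : IsSMulRegular M x := by
      by_contra hcon
      have : x ∈ ⋃ p ∈ associatedPrimes R M, (p : Set R) := by
        rw [biUnion_associatedPrimes_eq_compl_regular R M]
        exact hcon
      simp only [Set.mem_iUnion] at this
      obtain ⟨p, hp, hxp⟩ := this
      have hp : IsAssociatedPrime p M := hp
      let p' : PrimeSpectrum R := ⟨p, hp.isPrime⟩
      have h2 := hq_ass ys hys rys p' hp
      have hps : p' ∈ Module.support R (QuotSMulTop x M) := by
        rw [Module.support_quotSMulTop]
        refine ⟨Module.mem_support_iff_of_finite.2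
          (Submodule.annihilator_top (R := R) (M := M) ▸ hp.annihilator_le), ?_⟩
        simpa [PrimeSpectrum.mem_zeroLocus] using hxp
      have h3 := (hq_coheight_le p' hps).trans h1
      rw [hl] at h2
      have h4 := h2.trans (WithBot.coe_le_coe.1 h3)
      simp only [List.length_cons] at h4
      have := ENat.natCast_le_natCast.1 h4
      omega
    obtain ⟨ws, hwl, hws, rws⟩ := hq_depth xs.length x ys hl hx hys rx rys
    rw [isWeaklyRegular_cons_iff]
    exact ⟨rx, ih (M := QuotSMulTop x M) ws hwl hxs hws rws hdim⟩

theorem hq_hom_self {R P : Type*} [CommRing R] [AddCommGroup P] [Module R P] (I : Ideal R)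
    (h : ∀ r ∈ I, ∀ m : P, r • m = 0) : Nonempty (((R ⧸ I) →ₗ[R] P) ≃ₗ[R] P) := by
  refine ⟨LinearEquiv.ofBijective (LinearMap.applyₗ (1 : R ⧸ I)) ⟨?_, ?_⟩⟩
  · intro f g hfg
    refine LinearMap.ext fun x => ?_
    obtain ⟨r, rfl⟩ := Ideal.Quotient.mk_surjective x
    have : Ideal.Quotient.mk I r = r • (1 : R ⧸ I) := by
      rw [Algebra.smul_def, mul_one]; rfl
    rw [this, map_smul, map_smul]
    exact congrArg _ hfg
  · intro m
    refine ⟨Submodule.liftQ I (LinearMap.toSpanSingleton R P m) ?_, ?_⟩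
    · intro r hr
      simpa using h r hr m
    · have : (1 : R ⧸ I) = Submodule.Quotient.mk 1 := rfl
      rw [LinearMap.applyₗ_apply_apply, this, Submodule.liftQ_apply]
      simp

theorem hq_param {R M : Type*} [CommRing R] [IsNoetherianRing R]
    [IsLocalRing R] [AddCommGroup M] [Module R M] [Module.Finite R M]
    (d : ℕ) (hdim : moduleDim R M = (d : WithBot ℕ∞)) (hCM : IsCohenMacaulay R M)
    (I : Ideal R) (h : IsParameterIdeal R M I) :
    ∃ xs : List R, xs.length = d ∧ (∀ r ∈ xs, r ∈ maximalIdeal R) ∧ I = Ideal.ofList xs ∧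
      IsWeaklyRegular M xs := by
  obtain ⟨d', a, ⟨ha, hd, hfl⟩, rfl⟩ := h
  obtain rfl : d' = d := by
    rw [hd] at hdim
    exact_mod_cast hdim
  have hnt : Nontrivial M := by
    rw [← Module.supportDim_ne_bot_iff_nontrivial R M,
      Module.supportDim_eq_ringKrullDim_quotient_annihilator]
    change moduleDim R M ≠ ⊥
    rw [hd]
    exact WithBot.coe_ne_bot
  have hdep : moduleDepth R M = (d' : ℕ∞) := by
    have : (moduleDepth R M : WithBot ℕ∞) = _ := hCM
    rw [hd] at this
    exact WithBot.coe_injective this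
  obtain ⟨ys, hyl, hym, hyr⟩ : (d' : ℕ∞) ∈ {n : ℕ∞ | ∃ rs : List R, (rs.length : ℕ∞) = n ∧
      (∀ r ∈ rs, r ∈ nonunits R) ∧ RingTheory.Sequence.IsRegular M rs} := by
    have hne : Nonempty {n : ℕ∞ | ∃ rs : List R, (rs.length : ℕ∞) = n ∧
      (∀ r ∈ rs, r ∈ nonunits R) ∧ RingTheory.Sequence.IsRegular M rs} :=
      ⟨0, [], by simp, by simp, .nil R M⟩
    have := ENat.sSup_mem_of_nonempty_of_lt_top (s := {n : ℕ∞ | ∃ rs : List R,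
      (rs.length : ℕ∞) = n ∧
      (∀ r ∈ rs, r ∈ nonunits R) ∧ RingTheory.Sequence.IsRegular M rs})
      (by change moduleDepth R M < ⊤; rw [hdep]; exact ENat.natCast_lt_top _)
    change moduleDepth R M ∈ _ at this
    rwa [hdep] at this
  have hI : Ideal.span (Set.range a) = Ideal.ofList (List.ofFn a) := by
    unfold Ideal.ofList
    congr 1
    ext r
    simp [List.mem_ofFn]
  have hm : ∀ r ∈ List.ofFn a, r ∈ maximalIdeal R := by
    intro r hr
    obtain ⟨i, rfl⟩ := List.mem_ofFn.1 hr
    exact ha i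
  refine ⟨List.ofFn a, by simp, hm, hI, ?_⟩
  refine hq_sop _ ys (by simpa using hyl) hm hym hyr.toIsWeaklyRegular ?_
  rw [← hI]
  exact hq_dim_zero hfl

end Helpers

/-- consequence of Rees' theorem. If `M` is a Cohen-Macaulay finitely
generated module of dimension `d` over a commutative Noetherian local ring `R`, and
`𝔟 ⊆ 𝔞` are parameter ideals of `M`, then `Hom_R(R/𝔞, M/𝔟M) ≅ M/𝔞M` as `R`-modules. -/
theorem hom_quotient_iso_of_cohenMacaulay {R M : Type*} [CommRing R] [IsNoetherianRing R]
    [IsLocalRing R] [AddCommGroup M] [Module R M] [Module.Finite R M]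
    (d : ℕ) (hdim : moduleDim R M = (d : WithBot ℕ∞)) (hCM : IsCohenMacaulay R M)
    (𝔞 𝔟 : Ideal R) (ha : IsParameterIdeal R M 𝔞) (hb : IsParameterIdeal R M 𝔟) (hba : 𝔟 ≤ 𝔞) :
    Nonempty (((R ⧸ 𝔞) →ₗ[R] (M ⧸ (𝔟 • (⊤ : Submodule R M)))) ≃ₗ[R]
      (M ⧸ (𝔞 • (⊤ : Submodule R M)))) := by
  obtain ⟨xs, hxl, hxm, rfl, rx⟩ := hq_param d hdim hCM 𝔞 ha
  obtain ⟨ys, hyl, hym, rfl, ry⟩ := hq_param d hdim hCM 𝔟 hb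
  have hann : Module.annihilator R (R ⧸ Ideal.ofList xs) = Ideal.ofList xs :=
    Ideal.annihilator_quotient
  obtain ⟨e⟩ := hq_rees (Q := R ⧸ Ideal.ofList xs)
    (by rw [hann]; exact Ideal.span_le.2 hxm) ys (M := M) xs (by rw [hxl, hyl])
    (fun r hr => by rw [hann]; exact hba (Ideal.subset_span hr))
    (fun r hr => by rw [hann]; exact Ideal.subset_span hr) ry rx
  obtain ⟨e'⟩ := hq_hom_self (P := M ⧸ (Ideal.ofList xs • (⊤ : Submodule R M)))
    (Ideal.ofList xs) (by
      intro r hr m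
      obtain ⟨m, rfl⟩ := Submodule.Quotient.mk_surjective _ m
      rw [← Submodule.Quotient.mk_smul, Submodule.Quotient.mk_eq_zero]
      exact Submodule.smul_mem_smul hr trivial)
  exact ⟨e ≪≫ₗ e'⟩
end

section
/- Let A be any commutative ring, L an A-module, and a, b ∈ A. Then for arbitrary positive integers p ≤ q ≤ r one has the equality of submodules of L: (b a^r L :_L a^p) = a^{r-q}·(b a^q L :_L a^p) + (0 :_L a^p). -/
/-- For a commutative ring `A`, an `A`-module `L`, elements `a b : A` and
positive integers `p ≤ q ≤ r` one has `(b a^r L :_L a^p) = a^(r-q) (b a^q L :_L a^p) + (0 :_L a^p)`.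
Here `x N` is the image of `N` under multiplication by `x`, `(N :_L x) = {m ∈ L | x m ∈ N}` is
realized as a `comap`, and `(0 :_L x)` is the kernel of multiplication by `x`. -/
theorem colon_pow_smul_eq {A L : Type*} [CommRing A] [AddCommGroup L] [Module A L]
    (a b : A) (p q r : ℕ) (hp : 0 < p) (hpq : p ≤ q) (hqr : q ≤ r) :
    Submodule.comap (LinearMap.lsmul A L (a ^ p))
        (LinearMap.range (LinearMap.lsmul A L (b * a ^ r))) =
      Submodule.map (LinearMap.lsmul A L (a ^ (r - q)))
          (Submodule.comap (LinearMap.lsmul A L (a ^ p))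
            (LinearMap.range (LinearMap.lsmul A L (b * a ^ q)))) ⊔
        LinearMap.ker (LinearMap.lsmul A L (a ^ p)) := by
  obtain ⟨s, rfl⟩ := Nat.exists_eq_add_of_le hpq
  obtain ⟨t, rfl⟩ := Nat.exists_eq_add_of_le hqr
  rw [Nat.add_sub_cancel_left]
  apply le_antisymm
  · rintro m ⟨y, hy⟩
    simp only [LinearMap.lsmul_apply] at hy
    refine Submodule.mem_sup.2 ⟨a ^ t • (b * a ^ s) • y, ⟨(b * a ^ s) • y, ⟨y, ?_⟩, rfl⟩,
      m - a ^ t • (b * a ^ s) • y, ?_, by abel⟩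
    · simp only [LinearMap.lsmul_apply, smul_smul]
      congr 1
      ring
    · rw [LinearMap.mem_ker, LinearMap.lsmul_apply, smul_sub, ← hy, sub_eq_zero,
        smul_smul, smul_smul]
      congr 1
      ring
  · refine sup_le ?_ ?_
    · rintro _ ⟨n, ⟨y, hy⟩, rfl⟩
      simp only [LinearMap.lsmul_apply] at hy
      refine ⟨y, ?_⟩
      simp only [LinearMap.lsmul_apply]
      rw [smul_comm, ← hy, smul_smul]
      congr 1
      ring
    · intro m hm
      rw [LinearMap.mem_ker] at hm
      rw [Submodule.mem_comap, hm]
      exact Submodule.zero_mem _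
end

section
/- Let R be a commutative Noetherian local ring, J ⊆ I ideals of R with √I = √J, and N a nonzero finitely generated R-module. If Hom_R(R/J, N) is decomposable as an R-module, then Hom_R(R/I, N) is decomposable as an R-module. -/
theorem exists_killed_aux {R H : Type*} [CommRing R] [AddCommGroup H] [Module R H]
    (I : Ideal R) (X : Submodule R H) (hX : X ≠ ⊥) (n : ℕ)
    (hn : ∀ r ∈ I ^ n, ∀ x : H, r • x = 0) :
    ∃ x ∈ X, x ≠ 0 ∧ ∀ i ∈ I, i • x = 0 := by
  have key : ∃ k, ∀ r ∈ I ^ k, ∀ x ∈ X, r • x = 0 := ⟨n, fun r hr x _ => hn r hr x⟩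
  classical
  obtain ⟨k, hk, hmin⟩ : ∃ k, (∀ r ∈ I ^ k, ∀ x ∈ X, r • x = 0) ∧
      ∀ m < k, ¬ (∀ r ∈ I ^ m, ∀ x ∈ X, r • x = 0) :=
    ⟨Nat.find key, Nat.find_spec key, fun m hm => Nat.find_min key hm⟩
  cases k with
  | zero =>
    exfalso
    apply hX
    rw [Submodule.eq_bot_iff]
    intro x hx
    simpa using hk 1 (by simp) x hx
  | succ m =>
    have h1 := hmin m (Nat.lt_succ_self m)
    push Not at h1
    obtain ⟨r, hr, x, hx, hne⟩ := h1
    refine ⟨r • x, X.smul_mem r hx, hne, fun i hi => ?_⟩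
    rw [smul_smul]
    refine hk _ ?_ x hx
    rw [pow_succ, mul_comm i r]
    exact Ideal.mul_mem_mul hr hi

theorem exists_lift_aux {R N : Type*} [CommRing R] [AddCommGroup N] [Module R N]
    (I J : Ideal R) (hJI : J ≤ I) (x : (R ⧸ J) →ₗ[R] N) (hx : ∀ i ∈ I, i • x = 0) :
    ∃ t : (R ⧸ I) →ₗ[R] N, LinearMap.lcomp R N (Submodule.factor hJI) t = x := by
  refine ⟨Submodule.liftQ I (x.comp (Submodule.mkQ J)) ?_, ?_⟩
  · intro i hi
    have h1 := LinearMap.congr_fun (hx i hi) (Submodule.mkQ J 1)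
    rw [LinearMap.smul_apply, ← map_smul, ← map_smul] at h1
    simpa using h1
  · apply LinearMap.ext
    intro y
    obtain ⟨r, rfl⟩ := Submodule.mkQ_surjective J y
    rfl

/-- Let `J ⊆ I` be ideals of a Noetherian local ring with `√I = √J` and let
`N` be a nonzero finitely generated module. If `Hom_R(R/J, N)` is decomposable then so is
`Hom_R(R/I, N)`. -/
theorem isDecomposable_hom_of_isDecomposable_hom {R N : Type*} [CommRing R] [IsNoetherianRing R]
    [IsLocalRing R] [AddCommGroup N] [Module R N] [Module.Finite R N] [Nontrivial N]
    (I J : Ideal R) (hJI : J ≤ I) (hrad : I.radical = J.radical)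
    (h : IsDecomposable R ((R ⧸ J) →ₗ[R] N)) :
    IsDecomposable R ((R ⧸ I) →ₗ[R] N) := by
  set ι := LinearMap.lcomp R N (Submodule.factor hJI) with hι
  have hinj : Function.Injective ι := by
    intro a b hab
    apply LinearMap.ext
    intro y
    obtain ⟨r, rfl⟩ := Submodule.mkQ_surjective I y
    exact LinearMap.congr_fun hab (Submodule.mkQ J r)
  obtain ⟨n, hn⟩ : ∃ n, I ^ n ≤ J := by
    obtain ⟨n, hn⟩ := Ideal.exists_radical_pow_le_of_fg J (IsNoetherian.noetherian _)
    exact ⟨n, (Ideal.pow_right_mono (Ideal.le_radical.trans hrad.le) n).trans hn⟩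
  have hkill : ∀ r ∈ I ^ n, ∀ x : (R ⧸ J) →ₗ[R] N, r • x = 0 :=
    fun r hr x => homIsTorsion J N (x := x) (a := ⟨r, hn hr⟩)
  have hne : ∀ X : Submodule R ((R ⧸ J) →ₗ[R] N), X ≠ ⊥ → X.comap ι ≠ ⊥ := by
    intro X hX hbot
    obtain ⟨x, hxX, hx0, hxI⟩ := exists_killed_aux I X hX n hkill
    obtain ⟨t, rfl⟩ := exists_lift_aux I J hJI x hxI
    have ht : t ∈ X.comap ι := hxX
    rw [hbot, Submodule.mem_bot] at ht
    exact hx0 (by rw [ht, map_zero])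
  obtain ⟨X, Y, hX, hY, hXY⟩ := h
  refine ⟨X.comap ι, Y.comap ι, hne X hX, hne Y hY, ?_, ?_⟩
  · rw [Submodule.disjoint_def]
    intro t h1 h2
    apply hinj
    rw [map_zero]
    exact Submodule.disjoint_def.mp hXY.disjoint _ h1 h2
  · rw [codisjoint_iff, Submodule.eq_top_iff']
    intro t
    have h1 : ι t ∈ X ⊔ Y := by rw [hXY.sup_eq_top]; trivial
    obtain ⟨x, hx, y, hy, hxy⟩ := Submodule.mem_sup.mp h1
    have hsum : ∀ i ∈ I, i • x + i • y = 0 := by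
      intro i hi
      have h0 : i • t = 0 := homIsTorsion I N (x := t) (a := ⟨i, hi⟩)
      rw [← smul_add, hxy, ← map_smul, h0, map_zero]
    have hxI : ∀ i ∈ I, i • x = 0 := by
      intro i hi
      refine Submodule.disjoint_def.mp hXY.disjoint _ (X.smul_mem i hx) ?_
      rw [eq_neg_of_add_eq_zero_left (hsum i hi)]
      exact Y.neg_mem (Y.smul_mem i hy)
    have hyI : ∀ i ∈ I, i • y = 0 := by
      intro i hi
      simpa [hxI i hi] using hsum i hi
    obtain ⟨a, rfl⟩ := exists_lift_aux I J hJI x hxI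
    obtain ⟨b, rfl⟩ := exists_lift_aux I J hJI y hyI
    refine Submodule.mem_sup.mpr ⟨a, hx, b, hy, hinj ?_⟩
    rw [map_add]
    exact hxy
end

section
/- Let R be a commutative Noetherian local ring and M a finitely generated R-module of dimension d ≥ 2. If M is not Cohen-Macaulay, then for any system of parameters a_1, …, a_d of M there exist a positive integer s and an index i with 1 ≤ i ≤ d such that M/a_i^s M is not Cohen-Macaulay. -/
open RingTheory.Sequence IsLocalRing Pointwise in
theorem aux_supportDim_le_length {R : Type*} [CommRing R] [IsNoetherianRing R] [IsLocalRing R]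
    (rs : List R) {N : Type*} [AddCommGroup N] [Module R N] [Module.Finite R N]
    (hrs : ∀ r ∈ rs, r ∈ maximalIdeal R)
    (h : ∀ p ∈ Module.support R N, (∀ r ∈ rs, r ∈ p.asIdeal) → p = closedPoint R) :
    Module.supportDim R N ≤ (rs.length : WithBot ℕ∞) := by
  induction rs generalizing N with
  | nil =>
    have : Subsingleton (Module.support R N) := by
      refine ⟨fun p q => Subtype.ext ?_⟩
      rw [h p.1 p.2 (by simp), h q.1 q.2 (by simp)]
    simpa [Module.supportDim] using Order.krullDim_nonpos_of_subsingleton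
  | cons x rs ih =>
    refine (Module.supportDim_le_supportDim_quotSMulTop_succ (hrs x (by simp))).trans ?_
    have := ih (N := QuotSMulTop x N) (fun r hr => hrs r (by simp [hr])) (by
      intro p hp hp'
      rw [Module.support_quotSMulTop] at hp
      refine h p hp.1 ?_
      intro r hr
      rcases List.mem_cons.1 hr with rfl | hr
      · simpa using hp.2
      · exact hp' r hr)
    rw [List.length_cons]
    push_cast
    gcongr

open RingTheory.Sequence IsLocalRing Pointwise in
theorem aux_length_le_supportDim {R : Type*} [CommRing R] [IsNoetherianRing R] [IsLocalRing R]
    (rs : List R) {C : Type*} [AddCommGroup C] [Module R C] [Module.Finite R C]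
    (hrs : ∀ r ∈ rs, r ∈ maximalIdeal R) (hreg : IsRegular C rs)
    (L : Submodule R C) (hL : L ≠ ⊥) :
    (rs.length : WithBot ℕ∞) ≤ Module.supportDim R L := by
  induction rs generalizing C with
  | nil =>
    have : Nontrivial L := (Submodule.nontrivial_iff_ne_bot).2 hL
    have h1 := Module.supportDim_ne_bot_of_nontrivial R L
    rw [← WithBot.coe_unbot _ h1]
    exact WithBot.coe_le_coe.mpr zero_le
  | cons x rs ih =>
    have hx : x ∈ maximalIdeal R := hrs x (by simp)
    obtain ⟨hxr, hreg'⟩ := (isRegular_cons_iff C x rs).1 hreg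
    let f : ℕ →o Submodule R C :=
      { toFun := fun k => L.comap (LinearMap.lsmul R C (x ^ k))
        monotone' := by
          refine monotone_nat_of_le_succ fun k c hc => ?_
          simp only [Submodule.mem_comap, LinearMap.lsmul_apply] at hc ⊢
          rw [pow_succ', mul_smul]
          exact L.smul_mem _ hc }
    obtain ⟨k, hk⟩ := monotone_stabilizes_iff_noetherian.2 (inferInstance : IsNoetherian R C) f
    have hmem : ∀ n c, c ∈ f n ↔ x ^ n • c ∈ L := fun n c => Iff.rfl
    have hsat : ∀ c, x • c ∈ f k → c ∈ f k := by
      intro c hc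
      rw [hk (k + 1) (by omega), hmem, pow_succ, mul_smul]
      exact hc
    have hLk : L ≤ f k := fun c hc => L.smul_mem _ hc
    have hxk : IsSMulRegular C (x ^ k) := hxr.pow k
    have h1 : Module.supportDim R (f k) ≤ Module.supportDim R L := by
      refine Module.supportDim_le_of_injective
        ((LinearMap.lsmul R C (x ^ k)).restrict (p := f k) (q := L) (fun c hc => hc)) ?_
      intro a b hab
      exact Subtype.ext (hxk (congrArg Subtype.val hab))
    have hreg2 : IsSMulRegular (f k) x := fun a b hab =>
      Subtype.ext (hxr (congrArg Subtype.val hab))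
    have h2 := Module.supportDim_quotSMulTop_succ_eq_supportDim hreg2 hx
    let L2 : Submodule R (QuotSMulTop x C) := (f k).map (Submodule.mkQ _)
    have hL2 : L2 ≠ ⊥ := by
      intro h0
      refine hL (le_bot_iff.1 (hLk.trans (le_of_eq ?_)))
      refine Submodule.eq_bot_of_le_smul_of_le_jacobson_bot (Ideal.span {x}) (f k)
        (IsNoetherian.noetherian _) ?_ ?_
      · intro c hc
        have : (Submodule.mkQ (x • (⊤ : Submodule R C))) c ∈ L2 := Submodule.mem_map_of_mem hc
        rw [h0, Submodule.mem_bot, Submodule.mkQ_apply, Submodule.Quotient.mk_eq_zero] at this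
        obtain ⟨e, -, rfl⟩ := (Submodule.mem_smul_pointwise_iff_exists _ _ _).1 this
        exact Submodule.smul_mem_smul (Ideal.mem_span_singleton_self x) (hsat e hc)
      · rw [IsLocalRing.jacobson_eq_maximalIdeal _ bot_ne_top, Ideal.span_singleton_le_iff_mem]
        exact hx
    have h3 := ih (fun r hr => hrs r (by simp [hr])) hreg' L2 hL2
    have h4 : Module.supportDim R L2 ≤ Module.supportDim R (QuotSMulTop x (f k)) := by
      let g : f k →ₗ[R] L2 := (Submodule.mkQ _).restrict (fun c hc => Submodule.mem_map_of_mem hc)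
      refine Module.supportDim_le_of_surjective (Submodule.liftQ _ g ?_) ?_
      · intro c hc
        obtain ⟨e, -, rfl⟩ := (Submodule.mem_smul_pointwise_iff_exists _ _ _).1 hc
        refine Subtype.ext ((Submodule.Quotient.mk_eq_zero _).2 ?_)
        exact Submodule.smul_mem_pointwise_smul _ _ _ trivial
      · rintro ⟨_, c, hc, rfl⟩
        exact ⟨Submodule.Quotient.mk ⟨c, hc⟩, rfl⟩
    rw [List.length_cons]
    push_cast
    calc _ ≤ Module.supportDim R (QuotSMulTop x (f k)) + 1 := by gcongr; exact h3.trans h4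
      _ ≤ _ := h2.le.trans h1

open IsLocalRing in
theorem aux_closedPoint {R : Type*} [CommRing R] [IsNoetherianRing R] [IsLocalRing R]
    {Q : Type*} [AddCommGroup Q] [Module R Q] [Module.Finite R Q] (hQ : IsFiniteLength R Q)
    (p : PrimeSpectrum R) (hp : p ∈ Module.support R Q) : p = closedPoint R := by
  have hart : IsArtinian R Q := (isFiniteLength_iff_isNoetherian_isArtinian.1 hQ).2
  let f : ℕ →o (Submodule R Q)ᵒᵈ :=
    { toFun := fun k => OrderDual.toDual (maximalIdeal R ^ k • (⊤ : Submodule R Q))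
      monotone' := fun k l hkl =>
        Submodule.smul_mono_left (Ideal.pow_le_pow_right hkl) }
  obtain ⟨n, hn⟩ := IsArtinian.monotone_stabilizes f
  have h0 : maximalIdeal R ^ n • (⊤ : Submodule R Q) = ⊥ := by
    rw [← le_bot_iff, ← Ideal.iInf_pow_smul_eq_bot_of_isLocalRing (M := Q) (maximalIdeal R)
      (Ideal.IsPrime.ne_top inferInstance)]
    refine le_iInf fun m => ?_
    rcases le_total n m with h | h
    · exact (OrderDual.toDual.injective (hn m h)).le
    · exact Submodule.smul_mono_left (Ideal.pow_le_pow_right h)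
  have h1 : maximalIdeal R ^ n ≤ p.asIdeal := by
    refine le_trans ?_ (Module.mem_support_iff_of_finite.1 hp)
    intro r hr
    rw [Module.mem_annihilator]
    intro q
    have : r • q ∈ maximalIdeal R ^ n • (⊤ : Submodule R Q) :=
      Submodule.smul_mem_smul hr trivial
    rwa [h0] at this
  have h2 := p.2.le_of_pow_le h1
  exact PrimeSpectrum.ext (le_antisymm (le_maximalIdeal p.2.ne_top) h2)

open RingTheory.Sequence IsLocalRing Pointwise in
theorem aux_exists_regular {R : Type*} [CommRing R] [IsNoetherianRing R] [IsLocalRing R]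
    {C : Type*} [AddCommGroup C] [Module R C] [Module.Finite R C] (n : ℕ)
    (hC : IsCohenMacaulay R C) (hn : ((n + 1 : ℕ) : WithBot ℕ∞) ≤ Module.supportDim R C) :
    ∃ rs : List R, n + 1 ≤ rs.length ∧ (∀ r ∈ rs, r ∈ maximalIdeal R) ∧ IsRegular C rs := by
  rw [Module.supportDim_eq_ringKrullDim_quotient_annihilator] at hn
  change _ ≤ moduleDim R C at hn
  rw [← show _ = _ from hC] at hn
  have hn' : ((n + 1 : ℕ) : ℕ∞) ≤ moduleDepth R C := by exact_mod_cast hn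
  have : (n : ℕ∞) < moduleDepth R C :=
    lt_of_lt_of_le (by exact_mod_cast Nat.lt_succ_self n) hn'
  obtain ⟨_, ⟨rs, rfl, h1, h2⟩, h3⟩ := lt_sSup_iff.1 this
  exact ⟨rs, by exact_mod_cast h3, fun r hr => h1 r hr, h2⟩

/-- If `M` is a non-Cohen-Macaulay finitely generated module of dimension
`d ≥ 2` over a Noetherian local ring, then for any system of parameters `a₁, …, a_d` of `M`
there are an index `i` and a positive integer `s` such that `M/a_i^s M` is not Cohen-Macaulay. -/
theorem exists_quotient_pow_smul_not_cohenMacaulay {R M : Type*} [CommRing R]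
    [IsNoetherianRing R] [IsLocalRing R] [AddCommGroup M] [Module R M] [Module.Finite R M]
    (d : ℕ) (hd : 2 ≤ d) (hdim : moduleDim R M = (d : WithBot ℕ∞))
    (hM : ¬ IsCohenMacaulay R M) (a : Fin d → R) (ha : IsSystemOfParameters R M a) :
    ∃ (s : ℕ) (i : Fin d), 0 < s ∧
      ¬ IsCohenMacaulay R (M ⧸ (Ideal.span {a i ^ s} • (⊤ : Submodule R M))) := by
  classical
  by_contra! hcon
  have hdim' : Module.supportDim R M = (d : WithBot ℕ∞) := by
    rw [Module.supportDim_eq_ringKrullDim_quotient_annihilator]; exact hdim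
  obtain ⟨ham, -, hfl⟩ := ha
  have ham' : ∀ i, a i ∈ IsLocalRing.maximalIdeal R := ham
  have hnt : Nontrivial M := by
    rw [← Module.supportDim_ne_bot_iff_nontrivial R, hdim']
    exact WithBot.coe_ne_bot
  obtain ⟨n, rfl⟩ : ∃ n, d = n + 2 := ⟨d - 2, by omega⟩
  -- dimension of the quotients
  have hq : ∀ (s : ℕ) (i), 0 < s → ∃ rs : List R, n + 1 ≤ rs.length ∧
      (∀ r ∈ rs, r ∈ IsLocalRing.maximalIdeal R) ∧ RingTheory.Sequence.IsRegular
        (M ⧸ (Ideal.span {a i ^ s} • (⊤ : Submodule R M))) rs := by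
    intro s i hs
    refine aux_exists_regular n (hcon s i hs) ?_
    have h1 := Module.supportDim_le_supportDim_quotSMulTop_succ (M := M)
      (Ideal.pow_mem_of_mem _ (ham' i) s hs)
    have h2 : Module.supportDim R (QuotSMulTop (a i ^ s) M) =
        Module.supportDim R (M ⧸ (Ideal.span {a i ^ s} • (⊤ : Submodule R M))) :=
      Module.supportDim_eq_of_equiv
        (Submodule.quotEquivOfEq _ _ (Submodule.ideal_span_singleton_smul _ _).symm)
    rw [hdim', h2] at h1
    generalize Module.supportDim R (M ⧸ (Ideal.span {a i ^ s} • (⊤ : Submodule R M))) = D at h1 ⊢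
    induction D with
    | bot => simp at h1
    | coe D =>
      induction D with
      | top => exact le_top
      | coe D =>
        have h3 : n + 2 ≤ D + 1 := by
          have h4 : (((n + 2 : ℕ) : ℕ∞) : WithBot ℕ∞) ≤ (((D + 1 : ℕ) : ℕ∞) : WithBot ℕ∞) := h1
          exact Nat.cast_le.1 (WithBot.coe_le_coe.1 h4)
        have h5 : ((n + 1 : ℕ) : ℕ∞) ≤ ((D : ℕ) : ℕ∞) := Nat.cast_le.2 (by omega)
        exact WithBot.coe_le_coe.2 h5
  -- `a 0` is regular on `M`
  have hreg : IsSMulRegular M (a 0) := by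
    rw [isSMulRegular_iff_right_eq_zero_of_smul]
    intro x hx
    by_contra hx0
    have hI : (⨅ i : ℕ, Ideal.span {a 1} ^ i • ⊤ : Submodule R M) = ⊥ :=
      Ideal.iInf_pow_smul_eq_bot_of_isLocalRing _ (by
        rw [Ne, Ideal.span_singleton_eq_top]; exact ham 1)
    have : ∃ s : ℕ, x ∉ (Ideal.span {a 1 ^ s} • ⊤ : Submodule R M) := by
      by_contra! hall
      apply hx0
      rw [← Submodule.mem_bot R, ← hI, Submodule.mem_iInf]
      intro i
      rw [Ideal.span_singleton_pow]
      exact hall i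
    obtain ⟨s, hs⟩ := this
    have hspos : 0 < s := by
      rcases Nat.eq_zero_or_pos s with rfl | h
      · exact absurd (by simp) hs
      · exact h
    obtain ⟨rs, hlen, hrs, hrsreg⟩ := hq s 1 hspos
    let C := M ⧸ (Ideal.span {a 1 ^ s} • (⊤ : Submodule R M))
    let y : C := Submodule.Quotient.mk x
    have hy : y ≠ 0 := fun h => hs ((Submodule.Quotient.mk_eq_zero _).1 h)
    let L : Submodule R C := Submodule.span R {y}
    have hL : L ≠ ⊥ := by rwa [Ne, Submodule.span_singleton_eq_bot]
    have hlow := aux_length_le_supportDim rs hrs hrsreg L hL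
    have hann : ∀ r : R, r • y = 0 → r ∈ Module.annihilator R L := by
      intro r hr
      rw [Module.mem_annihilator]
      rintro ⟨z, hz⟩
      obtain ⟨t, rfl⟩ := Submodule.mem_span_singleton.1 hz
      refine Subtype.ext ?_
      change r • t • y = 0
      rw [smul_comm, hr, smul_zero]
    have hup := aux_supportDim_le_length (N := L) (List.ofFn fun i : Fin n => a i.succ.succ)
      (by
        intro r hr
        obtain ⟨i, rfl⟩ := (List.mem_ofFn' _ _).1 hr
        exact ham' _) (by
        intro p hp hall
        have hp' := Module.mem_support_iff_of_finite.1 hp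
        refine aux_closedPoint hfl p ?_
        rw [Module.support_quotient]
        refine ⟨Module.mem_support_iff_of_finite.2 ?_, ?_⟩
        · intro r hr
          refine hp' (hann r ?_)
          rw [Module.mem_annihilator] at hr
          change Submodule.Quotient.mk (r • x) = _
          rw [hr, Submodule.Quotient.mk_zero]
        · rw [PrimeSpectrum.mem_zeroLocus, SetLike.coe_subset_coe, Ideal.span_le]
          rintro _ ⟨i, rfl⟩
          refine Fin.cases ?_ (fun i => Fin.cases ?_ (fun i => ?_) i) i
          · refine hp' (hann _ ?_)
            change Submodule.Quotient.mk (a 0 • x) = _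
            rw [hx, Submodule.Quotient.mk_zero]
          · refine p.2.mem_of_pow_mem s (hp' (hann _ ?_))
            change Submodule.Quotient.mk (a 1 ^ s • x) = _
            rw [Submodule.Quotient.mk_eq_zero]
            exact Submodule.smul_mem_smul (Ideal.mem_span_singleton_self _) trivial
          · exact hall _ ((List.mem_ofFn' _ _).2 ⟨i, rfl⟩))
    rw [List.length_ofFn] at hup
    have := hlow.trans hup
    norm_cast at this
    omega
  apply hM
  unfold IsCohenMacaulay
  rw [hdim]
  have key : moduleDepth R M = ((n + 2 : ℕ) : ℕ∞) := by
    apply le_antisymm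
    · refine sSup_le ?_
      rintro _ ⟨rs, rfl, h1, h2⟩
      have := aux_length_le_supportDim rs (fun r hr => h1 r hr) h2 (⊤ : Submodule R M) top_ne_bot
      rw [Module.supportDim_eq_of_equiv Submodule.topEquiv, hdim'] at this
      exact_mod_cast this
    · obtain ⟨rs, hlen, hrs, hrsreg⟩ := hq 1 0 one_pos
      have e : (M ⧸ (Ideal.span {a 0 ^ 1} • (⊤ : Submodule R M))) ≃ₗ[R] QuotSMulTop (a 0) M :=
        Submodule.quotEquivOfEq _ _ (by rw [pow_one, Submodule.ideal_span_singleton_smul])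
      have h2 := (LinearEquiv.isRegular_congr e rs).1 hrsreg
      have h3 := RingTheory.Sequence.IsRegular.cons hreg h2
      have h4 : (((a 0 :: rs).length : ℕ) : ℕ∞) ≤ moduleDepth R M :=
        le_sSup ⟨_, rfl, by
          intro r hr
          rcases List.mem_cons.1 hr with rfl | hr
          · exact ham 0
          · exact hrs r hr, h3⟩
      refine le_trans ?_ h4
      rw [List.length_cons]
      exact_mod_cast (by omega : n + 2 ≤ rs.length + 1)
  rw [key]
  rfl
end

section
/- Let R be a commutative Noetherian local ring with maximal ideal 𝔪, M a nonzero finitely generated R-module of dimension one and depth zero, and n a positive integer such that 𝔪^n M ∩ Γ_𝔪(M) = (0). Then for any parameter a of M and any parameter b of M with b ∈ (a^{n+1}), the R-module Hom_R(R/(a), M/bM) is decomposable. -/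
open IsLocalRing

theorem aux_mem {R M : Type*} [CommRing R] [AddCommGroup M] [Module R M] {b : R} {x : M} :
    x ∈ Ideal.span {b} • (⊤ : Submodule R M) ↔ ∃ y, x = b • y := by
  rw [Submodule.ideal_span_singleton_smul, Submodule.mem_smul_pointwise_iff_exists]
  simp [eq_comm]

theorem aux_pow_smul_bot {R Q : Type*} [CommRing R] [IsLocalRing R] [IsNoetherianRing R]
    [AddCommGroup Q]
    [Module R Q] (h : IsFiniteLength R Q) : ∃ k : ℕ, (maximalIdeal R ^ k) • (⊤ : Submodule R Q) = ⊥ := by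
  obtain ⟨h1, h2⟩ := isFiniteLength_iff_isNoetherian_isArtinian.mp h
  obtain ⟨k, hk⟩ := IsArtinian.monotone_stabilizes (R := R) (M := Q)
    ⟨fun k => OrderDual.toDual ((maximalIdeal R ^ k) • (⊤ : Submodule R Q)), fun i j hij =>
      Submodule.smul_mono_left (Ideal.pow_le_pow_right hij)⟩
  refine ⟨k, ?_⟩
  have h3 : (maximalIdeal R ^ k) • (⊤ : Submodule R Q) = (maximalIdeal R ^ (k+1)) • ⊤ :=
    hk (k+1) (Nat.le_succ k)
  refine Submodule.eq_bot_of_le_smul_of_le_jacobson_bot (maximalIdeal R) _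
    (IsNoetherian.noetherian _) ?_ (IsLocalRing.maximalIdeal_le_jacobson _)
  rw [← Submodule.smul_assoc, smul_eq_mul, ← pow_succ', ← h3]

theorem aux_param {R M : Type*} [CommRing R] [IsLocalRing R] [IsNoetherianRing R]
    [AddCommGroup M] [Module R M] {a : R} (ha : IsParameter R M a) :
    ∃ k : ℕ, ∀ r ∈ maximalIdeal R ^ k, ∀ x : M, ∃ y : M, r • x = a • y := by
  obtain ⟨k, hk⟩ := aux_pow_smul_bot ha.2
  refine ⟨k, fun r hr x => ?_⟩
  have h1 : r • (Submodule.Quotient.mk x : M ⧸ (Ideal.span {a} • (⊤ : Submodule R M))) = 0 := by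
    rw [← Submodule.mem_bot R, ← hk]
    exact Submodule.smul_mem_smul hr trivial
  rw [← Submodule.Quotient.mk_smul, Submodule.Quotient.mk_eq_zero] at h1
  exact aux_mem.mp h1

theorem aux_pow {R M : Type*} [CommRing R] [AddCommGroup M] [Module R M] {a : R} {I : Ideal R}
    (h : ∀ r ∈ I, ∀ x : M, ∃ y : M, r • x = a • y) (j : ℕ) :
    ∀ r ∈ I ^ j, ∀ x : M, ∃ y : M, r • x = a ^ j • y := by
  induction j with
  | zero => intro r _ x; exact ⟨r • x, by simp⟩
  | succ j ih =>
    intro r hr x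
    rw [pow_succ] at hr
    refine Submodule.mul_induction_on hr ?_ ?_
    · intro s hs t ht
      obtain ⟨y, hy⟩ := h t ht x
      obtain ⟨z, hz⟩ := ih s hs y
      exact ⟨z, by rw [mul_smul, hy, smul_comm, hz, smul_smul, pow_succ']⟩
    · rintro s t ⟨y, hy⟩ ⟨z, hz⟩
      exact ⟨y + z, by rw [add_smul, hy, hz, smul_add]⟩

theorem aux_ker_gamma {R M : Type*} [CommRing R] [IsLocalRing R] [IsNoetherianRing R]
    [AddCommGroup M] [Module R M] [Module.Finite R M] {a : R} (ha : IsParameter R M a)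
    (x : M) (hx : a • x = 0) : x ∈ torsionGamma (maximalIdeal R) M := by
  obtain ⟨k, hk⟩ := aux_param ha
  obtain ⟨j, hj⟩ := monotone_stabilizes_iff_noetherian.mpr (inferInstance : IsNoetherian R M)
    (LinearMap.iterateKer (LinearMap.lsmul R M a))
  refine ⟨k * j, fun r hr => ?_⟩
  rw [pow_mul] at hr
  obtain ⟨y, hy⟩ := aux_pow hk j r hr x
  have key : ∀ i : ℕ, ∀ z : M, ((LinearMap.lsmul R M a) ^ i) z = a ^ i • z := by
    intro i
    induction i with
    | zero => intro z; simp
    | succ i ih => intro z; rw [pow_succ, Module.End.mul_apply, ih, LinearMap.lsmul_apply, smul_smul, pow_succ]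
  have h1 : y ∈ LinearMap.ker ((LinearMap.lsmul R M a) ^ (j+1)) := by
    rw [LinearMap.mem_ker, key, pow_succ', mul_smul, ← hy, smul_comm, hx, smul_zero]
  have h2 : LinearMap.ker ((LinearMap.lsmul R M a) ^ j) =
    LinearMap.ker ((LinearMap.lsmul R M a) ^ (j+1)) := hj (j+1) (Nat.le_succ j)
  rw [← h2, LinearMap.mem_ker, key] at h1
  rw [hy, h1]

theorem aux_dim {R M : Type*} [CommRing R] [IsLocalRing R] [IsNoetherianRing R]
    [AddCommGroup M] [Module R M] (hdim : moduleDim R M = (1 : WithBot ℕ∞))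
    (k : ℕ) (hk : ∀ r ∈ maximalIdeal R ^ k, ∀ x : M, r • x = 0) : False := by
  have : Ring.KrullDimLE 0 (R ⧸ Module.annihilator R M) := by
    rw [Ring.krullDimLE_zero_iff]
    intro p hp
    have h1 : maximalIdeal R ≤ p.comap (Ideal.Quotient.mk _) := by
      have : (p.comap (Ideal.Quotient.mk (Module.annihilator R M))).IsPrime := inferInstance
      refine this.le_of_pow_le (n := k) ?_
      intro r hr
      rw [Ideal.mem_comap, Ideal.Quotient.eq_zero_iff_mem.mpr]
      · exact p.zero_mem
      · exact Module.mem_annihilator.mpr (hk r hr)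
    have h2 : (p.comap (Ideal.Quotient.mk (Module.annihilator R M))).IsMaximal := by
      have h3 := (maximalIdeal.isMaximal R).eq_of_le
        (Ideal.IsPrime.ne_top (inferInstance : (p.comap (Ideal.Quotient.mk (Module.annihilator R M))).IsPrime)) h1
      rw [← h3]; infer_instance
    exact Ideal.isMaximal_of_isIntegral_of_isMaximal_comap (R := R) p h2
  have h := Ring.krullDimLE_iff.mp this
  rw [moduleDim] at hdim
  rw [hdim] at h
  exact absurd h (by decide)

theorem aux_regular {R M : Type*} [CommRing R] [IsLocalRing R] [IsNoetherianRing R]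
    [AddCommGroup M] [Module R M] [Module.Finite R M] [Nontrivial M]
    (hdepth : moduleDepth R M = 0) {a : R} (ha : a ∈ nonunits R) : ∃ x : M, x ≠ 0 ∧ a • x = 0 := by
  by_contra! hcon
  have hreg : RingTheory.Sequence.IsRegular M [a] := by
    rw [IsLocalRing.isRegular_iff_isWeaklyRegular_of_subset_maximalIdeal]
    · rw [RingTheory.Sequence.isWeaklyRegular_singleton_iff, isSMulRegular_iff_right_eq_zero_of_smul]
      intro x hx
      by_contra h
      exact hcon x h hx
    · simpa using ha
  have h1 : (1 : ℕ∞) ≤ moduleDepth R M := le_sSup ⟨[a], by simp, by simpa using ha, hreg⟩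
  rw [hdepth] at h1
  exact absurd h1 (by decide)

/-- Theorem 3.1, dimension one. Let `M` be a nonzero finitely generated
module of dimension one and depth zero over a Noetherian local ring, and `n > 0` with
`𝔪^n M ∩ Γ_𝔪(M) = 0`. For any parameter `a` of `M` and any parameter `b ∈ (a^(n+1))` of `M`,
the `R`-module `Hom_R(R/(a), M/bM)` is decomposable. -/
theorem isDecomposable_hom_dim_one {R M : Type*} [CommRing R] [IsNoetherianRing R]
    [IsLocalRing R] [AddCommGroup M] [Module R M] [Module.Finite R M] [Nontrivial M]
    (hdim : moduleDim R M = (1 : WithBot ℕ∞)) (hdepth : moduleDepth R M = 0)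
    (n : ℕ) (hn : 0 < n)
    (hGamma : ((maximalIdeal R ^ n) • (⊤ : Submodule R M)) ⊓ torsionGamma (maximalIdeal R) M = ⊥)
    (a : R) (ha : IsParameter R M a)
    (b : R) (hb : IsParameter R M b) (hba : b ∈ Ideal.span {a ^ (n + 1)}) :
    IsDecomposable R ((R ⧸ Ideal.span {a}) →ₗ[R]
      (M ⧸ (Ideal.span {b} • (⊤ : Submodule R M)))) := by
  obtain ⟨c, hc⟩ := Ideal.mem_span_singleton.mp hba
  have haM : a ∈ maximalIdeal R := ha.1
  have hmem : ∀ x m : M, x = (a ^ n * c) • m → a • x = 0 → x = 0 := by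
    intro x m hx hax
    have : x ∈ ((maximalIdeal R ^ n) • (⊤ : Submodule R M)) ⊓ torsionGamma (maximalIdeal R) M := by
      refine ⟨?_, aux_ker_gamma ha x hax⟩
      rw [hx]
      exact Submodule.smul_mem_smul (Ideal.mul_mem_right _ _ (Ideal.pow_mem_pow haM n)) trivial
    rwa [hGamma] at this
  have hbc : ∀ m : M, b • m = (a ^ n * c) • a • m := by
    intro m; rw [hc, smul_smul]; congr 1; ring
  have hlift : ∀ u : M, (∃ y, a • u = b • y) → ∃ φ : (R ⧸ Ideal.span {a}) →ₗ[R]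
      (M ⧸ (Ideal.span {b} • (⊤ : Submodule R M))), φ 1 = Submodule.Quotient.mk u := by
    intro u hu
    refine ⟨Submodule.liftQ _ (LinearMap.toSpanSingleton R _ (Submodule.Quotient.mk u)) ?_, ?_⟩
    · rw [Ideal.span, Submodule.span_le]
      rintro _ rfl
      rw [SetLike.mem_coe, LinearMap.mem_ker, LinearMap.toSpanSingleton_apply,
        ← Submodule.Quotient.mk_smul, Submodule.Quotient.mk_eq_zero]
      exact aux_mem.mpr hu
    · change (1 : R) • (Submodule.Quotient.mk u : M ⧸ (Ideal.span {b} • (⊤ : Submodule R M))) = _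
      rw [one_smul]
  have hext : ∀ φ ψ : (R ⧸ Ideal.span {a}) →ₗ[R]
      (M ⧸ (Ideal.span {b} • (⊤ : Submodule R M))), φ 1 = ψ 1 → φ = ψ := by
    intro φ ψ h
    refine LinearMap.ext fun x => ?_
    obtain ⟨r, rfl⟩ := Ideal.Quotient.mk_surjective x
    have : (Ideal.Quotient.mk (Ideal.span {a}) r) = r • 1 := by
      rw [Algebra.smul_def, mul_one]; rfl
    rw [this, map_smul, map_smul, h]
  let e : ((R ⧸ Ideal.span {a}) →ₗ[R] (M ⧸ (Ideal.span {b} • (⊤ : Submodule R M)))) →ₗ[R]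
      (M ⧸ (Ideal.span {b} • (⊤ : Submodule R M))) := LinearMap.applyₗ (1 : R ⧸ Ideal.span {a})
  have he : ∀ φ, e φ = φ 1 := fun _ => rfl
  refine ⟨((LinearMap.ker (LinearMap.lsmul R M a)).map (Submodule.mkQ _)).comap e,
    ((LinearMap.range (LinearMap.lsmul R M (a ^ n * c))).map (Submodule.mkQ _)).comap e,
    ?_, ?_, ?_, ?_⟩
  · obtain ⟨x, hx0, hx⟩ := aux_regular hdepth ha.1 (M := M)
    obtain ⟨φ, hφ⟩ := hlift x ⟨0, by simp [hx]⟩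
    rw [Submodule.ne_bot_iff]
    refine ⟨φ, ⟨x, hx, hφ.symm⟩, ?_⟩
    rintro rfl
    rw [LinearMap.zero_apply, eq_comm, Submodule.Quotient.mk_eq_zero, aux_mem] at hφ
    obtain ⟨y, hy⟩ := hφ
    exact hx0 (hmem x (a • y) (by rw [hy, hbc]) hx)
  · intro hbot
    have h1 : ∀ m : M, ∃ y, (a ^ n * c) • m = b • y := by
      intro m
      obtain ⟨φ, hφ⟩ := hlift ((a ^ n * c) • m) ⟨m, by rw [hbc, smul_comm]⟩
      have : φ = 0 := by
        rw [← Submodule.mem_bot R, ← hbot]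
        exact ⟨_, ⟨m, rfl⟩, hφ.symm⟩
      rw [this, LinearMap.zero_apply, eq_comm, Submodule.Quotient.mk_eq_zero, aux_mem] at hφ
      exact hφ
    have h2 : LinearMap.range (LinearMap.lsmul R M (a ^ n * c)) = ⊥ := by
      refine Submodule.eq_bot_of_le_smul_of_le_jacobson_bot (maximalIdeal R) _
        (IsNoetherian.noetherian _) ?_ (IsLocalRing.maximalIdeal_le_jacobson _)
      rintro _ ⟨m, rfl⟩
      obtain ⟨y, hy⟩ := h1 m
      rw [LinearMap.lsmul_apply, hy, hbc, smul_comm]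
      exact Submodule.smul_mem_smul haM ⟨y, rfl⟩
    obtain ⟨k, hk⟩ := aux_param hb
    refine aux_dim hdim k fun r hr x => ?_
    obtain ⟨y, hy⟩ := hk r hr x
    rw [hy, hbc, ← Submodule.mem_bot R, ← h2]
    exact ⟨a • y, rfl⟩
  · rw [Submodule.disjoint_def]
    rintro φ ⟨x, hx, hxe⟩ ⟨_, ⟨m, rfl⟩, hme⟩
    have h1 : x - (a ^ n * c) • m ∈ Ideal.span {b} • (⊤ : Submodule R M) := by
      rw [← Submodule.Quotient.eq]
      exact hxe.trans hme.symm
    obtain ⟨y, hy⟩ := aux_mem.mp h1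
    have h2 : x = 0 := hmem x (a • y + m) (by rw [smul_add, ← hbc, ← hy, sub_add_cancel]) hx
    apply hext
    rw [← he, ← hxe, h2, map_zero, LinearMap.zero_apply]
  · rw [codisjoint_iff, eq_top_iff]
    rintro φ -
    obtain ⟨x, hx⟩ := Submodule.Quotient.mk_surjective _ (φ 1)
    have h1 : a • φ 1 = 0 := by
      rw [← map_smul]
      have : a • (1 : R ⧸ Ideal.span {a}) = 0 := by
        rw [Algebra.smul_def, mul_one]
        exact Ideal.Quotient.eq_zero_iff_mem.mpr (Ideal.mem_span_singleton_self a)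
      rw [this, map_zero]
    rw [← hx, ← Submodule.Quotient.mk_smul, Submodule.Quotient.mk_eq_zero, aux_mem] at h1
    obtain ⟨m, hm⟩ := h1
    have h2 : a • (x - (a ^ n * c) • m) = 0 := by
      rw [smul_sub, hm, hbc, smul_comm a, sub_self]
    obtain ⟨φ₁, hφ₁⟩ := hlift (x - (a ^ n * c) • m) ⟨0, by rw [h2, smul_zero]⟩
    obtain ⟨φ₂, hφ₂⟩ := hlift ((a ^ n * c) • m) ⟨m, by rw [hbc, smul_comm]⟩
    refine Submodule.mem_sup.mpr ⟨φ₁, ⟨_, h2, hφ₁.symm⟩, φ₂, ⟨_, ⟨m, rfl⟩, hφ₂.symm⟩, ?_⟩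
    apply hext
    rw [LinearMap.add_apply, hφ₁, hφ₂, ← Submodule.Quotient.mk_add, sub_add_cancel, hx]
end

section
/- Let R be a commutative Noetherian local ring of dimension one and depth zero with maximal ideal 𝔪, and n a positive integer such that 𝔪^n ∩ Γ_𝔪(R) = (0). Then for any parameter a ∈ 𝔪^n of R and any parameter b ∈ (a^2) of R, the R/(a)-module Hom_R(R/(a), R/(b)) is decomposable and has a non-free direct summand; in particular it is not a free R/(a)-module. -/
open IsLocalRing

theorem aux_artin {R : Type*} [CommRing R] {a : R} (ha : IsParameter R R a) :
    IsArtinianRing (R ⧸ Ideal.span {a}) := by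
  have h := (isFiniteLength_iff_isNoetherian_isArtinian.mp ha.2).2
  have e : (Ideal.span {a} • (⊤ : Submodule R R)) = Ideal.span {a} := by simp
  rw [e] at h
  exact isArtinian_of_tower R h

theorem aux_ne_zero {R : Type*} [CommRing R] [IsNoetherianRing R] [IsLocalRing R]
    (hdim : ringKrullDim R = 1) {a : R} (ha : IsParameter R R a) : a ≠ 0 := by
  rintro rfl
  have h := aux_artin ha
  have e : Ideal.span {(0 : R)} = ⊥ := by simp
  rw [e] at h
  have : IsArtinianRing R := (RingEquiv.quotientBot R).surjective.isArtinianRing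
  have h0 : Ring.KrullDimLE 0 R := inferInstance
  rw [Ring.krullDimLE_iff, hdim] at h0
  norm_num at h0

theorem aux_pow_s8 {R : Type*} [CommRing R] [IsNoetherianRing R] [IsLocalRing R]
    {a : R} (ha : IsParameter R R a) : ∃ k, maximalIdeal R ^ k ≤ Ideal.span {a} := by
  have h := aux_artin ha
  exact exists_maximalIdeal_pow_le_of_isArtinianRing_quotient _

theorem aux_smul {R : Type*} [CommRing R] (I : Ideal R) {N : Type*} [AddCommGroup N]
    [Module R N] [Module (R ⧸ I) ((R ⧸ I) →ₗ[R] N)] [IsScalarTower R (R ⧸ I) ((R ⧸ I) →ₗ[R] N)]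
    (r : R) (φ : (R ⧸ I) →ₗ[R] N) : (Ideal.Quotient.mk I r) • φ = r • φ := by
  have : Ideal.Quotient.mk I r = r • (1 : R ⧸ I) := by
    rw [Algebra.smul_def, mul_one]; rfl
  rw [this, smul_assoc, one_smul]

theorem aux_ext {R : Type*} [CommRing R] {I : Ideal R} {N : Type*} [AddCommGroup N]
    [Module R N] {φ ψ : (R ⧸ I) →ₗ[R] N} (h : φ 1 = ψ 1) : φ = ψ := by
  ext
  exact h

/-- homs sending 1 into the image of an ideal. -/
def auxSub {R : Type*} [CommRing R] (I J K : Ideal R)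
    [Module (R ⧸ I) ((R ⧸ I) →ₗ[R] (R ⧸ J))]
    [IsScalarTower R (R ⧸ I) ((R ⧸ I) →ₗ[R] (R ⧸ J))] :
    Submodule (R ⧸ I) ((R ⧸ I) →ₗ[R] (R ⧸ J)) where
  carrier := {φ | ∃ g ∈ K, φ 1 = Ideal.Quotient.mk J g}
  zero_mem' := ⟨0, K.zero_mem, by simp⟩
  add_mem' := by
    rintro φ ψ ⟨g, hg, h⟩ ⟨g', hg', h'⟩
    exact ⟨g + g', K.add_mem hg hg', by simp [h, h']⟩
  smul_mem' := by
    rintro c φ ⟨g, hg, h⟩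
    obtain ⟨r, rfl⟩ := Ideal.Quotient.mk_surjective c
    refine ⟨r * g, K.mul_mem_left r hg, ?_⟩
    rw [aux_smul, LinearMap.smul_apply, h]
    rfl

theorem aux_exists {R : Type*} [CommRing R] (a : R) {J : Ideal R} {x : R} (h : a * x ∈ J) :
    ∃ φ : (R ⧸ Ideal.span {a}) →ₗ[R] (R ⧸ J), φ 1 = Ideal.Quotient.mk J x := by
  refine ⟨Submodule.liftQ (Ideal.span {a}) (LinearMap.toSpanSingleton R (R ⧸ J)
    (Ideal.Quotient.mk J x)) ?_, ?_⟩
  · rw [Ideal.span, Submodule.span_le]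
    rintro _ rfl
    exact Ideal.Quotient.eq_zero_iff_mem.mpr h
  · have : (1 : R ⧸ Ideal.span {a}) = Submodule.Quotient.mk 1 := rfl
    rw [this, Submodule.liftQ_apply]
    simp

theorem aux_free {S M : Type*} [CommRing S] [IsLocalRing S] [AddCommGroup M] [Module S M]
    [Module.Free S M] [Module.Finite S M] {X Y : Submodule S M} (h : IsCompl X Y) :
    Module.Free S X := by
  have hproj : Module.Projective S X :=
    Module.Projective.of_split X.subtype (Submodule.projectionOnto X Y h)
      (Submodule.projectionOnto_comp_subtype h)
  have hXfin : Module.Finite S X :=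
    Module.Finite.of_surjective _ (Submodule.projectionOnto_surjective h)
  exact Module.free_of_flat_of_isLocalRing

/-- Theorem 3.3. Let `R` be a Noetherian local ring of dimension one and
depth zero and `n > 0` with `𝔪^n ∩ Γ_𝔪(R) = 0`. For any parameter `a ∈ 𝔪^n` and any
parameter `b ∈ (a^2)`, the `R/(a)`-module `Hom_R(R/(a), R/(b))` is decomposable with a
non-free direct summand; in particular it is not free over `R/(a)`.
The (unique) `R/(a)`-module structure compatible with the `R`-module structure is taken as
an instance hypothesis. -/
theorem isDecomposable_not_free_hom_dim_one {R : Type*} [CommRing R] [IsNoetherianRing R]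
    [IsLocalRing R]
    (hdim : ringKrullDim R = 1) (hdepth : moduleDepth R R = 0)
    (n : ℕ) (hn : 0 < n)
    (hGamma : (maximalIdeal R ^ n : Ideal R) ⊓ torsionGamma (maximalIdeal R) R = ⊥)
    (a : R) (han : a ∈ maximalIdeal R ^ n) (ha : IsParameter R R a)
    (b : R) (hba : b ∈ Ideal.span {a ^ 2}) (hb : IsParameter R R b)
    [Module (R ⧸ Ideal.span {a}) ((R ⧸ Ideal.span {a}) →ₗ[R] (R ⧸ Ideal.span {b}))]
    [IsScalarTower R (R ⧸ Ideal.span {a})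
      ((R ⧸ Ideal.span {a}) →ₗ[R] (R ⧸ Ideal.span {b}))] :
    IsDecomposable (R ⧸ Ideal.span {a}) ((R ⧸ Ideal.span {a}) →ₗ[R] (R ⧸ Ideal.span {b})) ∧
    (∃ X Y : Submodule (R ⧸ Ideal.span {a})
        ((R ⧸ Ideal.span {a}) →ₗ[R] (R ⧸ Ideal.span {b})),
      X ≠ ⊥ ∧ Y ≠ ⊥ ∧ IsCompl X Y ∧ ¬ Module.Free (R ⧸ Ideal.span {a}) X) ∧
    ¬ Module.Free (R ⧸ Ideal.span {a})
        ((R ⧸ Ideal.span {a}) →ₗ[R] (R ⧸ Ideal.span {b})) := by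
  classical
  set Γ := torsionGamma (maximalIdeal R) R with hΓ
  have haΓ : ∀ x, x ∈ Γ ↔ a * x = 0 := by
    intro x
    constructor
    · intro hx
      have : a * x ∈ (maximalIdeal R ^ n : Ideal R) ⊓ Γ :=
        ⟨Ideal.mul_mem_right _ _ han, Γ.smul_mem a hx⟩
      rwa [hGamma] at this
    · intro hx
      obtain ⟨k, hk⟩ := aux_pow_s8 ha
      refine ⟨k, fun r hr => ?_⟩
      obtain ⟨s, rfl⟩ := Ideal.mem_span_singleton'.mp (hk hr)
      rw [smul_eq_mul, mul_assoc, hx, mul_zero]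
  have hdisj : ∀ x, a * x ∈ Γ → a * x = 0 := by
    intro x hx
    have : a * x ∈ (maximalIdeal R ^ n : Ideal R) ⊓ Γ :=
        ⟨Ideal.mul_mem_right _ _ han, hx⟩
    rwa [hGamma] at this
  have ha0 := aux_ne_zero hdim ha
  have hb0 := aux_ne_zero hdim hb
  have hane : Ideal.span {a} ≠ ⊤ := by
    rw [Ne, Ideal.span_singleton_eq_top]; exact ha.1
  have hnt : Nontrivial (R ⧸ Ideal.span {a}) := Ideal.Quotient.nontrivial_iff.mpr hane
  have hloc := IsLocalRing.of_surjective' (Ideal.Quotient.mk (Ideal.span {a}))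
    Ideal.Quotient.mk_surjective
  have hΓne : ∃ g ∈ Γ, g ≠ 0 := by
    by_contra! hcon
    have hreg : RingTheory.Sequence.IsRegular R [a] := by
      refine ⟨?_, ?_⟩
      · rw [RingTheory.Sequence.isWeaklyRegular_singleton_iff, isSMulRegular_iff_right_eq_zero_of_smul]
        exact fun x hx => hcon x ((haΓ x).mpr hx)
      · simpa using hane.symm
    have : (1 : ℕ∞) ≤ moduleDepth R R :=
      le_sSup ⟨[a], by simp, by simpa using ha.1, hreg⟩
    rw [hdepth] at this
    norm_num at this
  obtain ⟨c, hc⟩ := Ideal.mem_span_singleton.mp hba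
  have hΓm : ∀ g ∈ Γ, g ∈ maximalIdeal R := by
    intro g hg hu
    have := (haΓ g).mp hg
    exact ha0 ((hu.mul_left_eq_zero).mp this)
  set X := auxSub (Ideal.span {a}) (Ideal.span {b}) Γ with hX
  set Y := auxSub (Ideal.span {a}) (Ideal.span {b}) (Ideal.span {a * c}) with hY
  have hbmem : ∀ x, x ∈ (Ideal.span {b}) → ∃ y, x = a * (a * c * y) := by
    intro x hx
    obtain ⟨y, rfl⟩ := Ideal.mem_span_singleton.mp hx
    exact ⟨y, by rw [hc]; ring⟩
  have hXne : X ≠ ⊥ := by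
    obtain ⟨g, hg, hg0⟩ := hΓne
    obtain ⟨φ, hφ⟩ := aux_exists a (J := Ideal.span {b}) (x := g) (by rw [(haΓ g).mp hg]; exact Ideal.zero_mem _)
    intro h
    have : φ ∈ X := ⟨g, hg, hφ⟩
    rw [h, Submodule.mem_bot] at this
    subst this
    have := Ideal.Quotient.eq_zero_iff_mem.mp hφ.symm
    obtain ⟨y, rfl⟩ := hbmem _ this
    exact hg0 (hdisj _ hg)
  have hYne : Y ≠ ⊥ := by
    obtain ⟨φ, hφ⟩ := aux_exists a (J := Ideal.span {b}) (x := a * c)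
      (Ideal.mem_span_singleton.mpr ⟨1, by rw [hc]; ring⟩)
    intro h
    have : φ ∈ Y := ⟨a * c, Ideal.mem_span_singleton_self _, hφ⟩
    rw [h, Submodule.mem_bot] at this
    subst this
    have := Ideal.Quotient.eq_zero_iff_mem.mp hφ.symm
    obtain ⟨y, hy⟩ := hbmem _ this
    have hu : IsUnit (1 - a * y) := by
      have := IsLocalRing.isUnit_or_isUnit_one_sub_self (a * y)
      refine this.resolve_left fun h => ha.1 (isUnit_of_mul_isUnit_left h)
    have h1 : (a * c) * (1 - a * y) = 0 := by linear_combination hy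
    have h2 : a * c = 0 := (hu.mul_left_eq_zero).mp h1
    exact hb0 (by rw [hc]; linear_combination a * h2)
  have hcompl : IsCompl X Y := by
    constructor
    · rw [Submodule.disjoint_def]
      rintro φ ⟨g, hg, h⟩ ⟨g', hg', h'⟩
      obtain ⟨z, rfl⟩ := Ideal.mem_span_singleton.mp hg'
      have := Ideal.Quotient.eq.mp (h.symm.trans h')
      obtain ⟨y, hy⟩ := hbmem _ this
      have hg2 : g = a * (c * z + a * c * y) := by linear_combination hy
      have hg0 : g = 0 := by rw [hg2] at hg ⊢; exact hdisj _ hg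
      apply aux_ext
      rw [h, hg0, map_zero]; rfl
    · rw [codisjoint_iff, eq_top_iff]
      intro φ _
      obtain ⟨x, hx⟩ := Ideal.Quotient.mk_surjective (φ 1)
      have hax : a * x ∈ (Ideal.span {b}) := by
        rw [← Ideal.Quotient.eq_zero_iff_mem, map_mul, hx]
        have := LinearMap.congr_fun (@homIsTorsion R _ (Ideal.span {a}) (R ⧸ (Ideal.span {b})) _ _ φ
          ⟨a, Ideal.mem_span_singleton_self a⟩) 1
        exact this
      obtain ⟨y, hy⟩ := hbmem _ hax
      have hg : x - a * c * y ∈ Γ := (haΓ _).mpr (by linear_combination hy)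
      obtain ⟨ψ, hψ⟩ := aux_exists a (J := Ideal.span {b}) (x := x - a * c * y)
        (by rw [(haΓ _).mp hg]; exact Ideal.zero_mem _)
      rw [Submodule.mem_sup]
      refine ⟨ψ, ⟨_, hg, hψ⟩, φ - ψ, ⟨a * c * y, Ideal.mul_mem_right _ _ (Ideal.mem_span_singleton_self _), ?_⟩, by abel⟩
      rw [LinearMap.sub_apply, hψ, ← hx, ← map_sub]
      congr 1
      ring
  have hXfree : ¬ Module.Free (R ⧸ Ideal.span {a}) X := by
    intro hfree
    have hXnt : Nontrivial X := Submodule.nontrivial_iff_ne_bot.mpr hXne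
    let B := Module.Free.chooseBasis (R ⧸ Ideal.span {a}) X
    obtain ⟨i⟩ := B.index_nonempty
    obtain ⟨g, hg, h⟩ := (B i).2
    have key : ∀ r : R, r * g ∈ Ideal.span {a} → r ∈ Ideal.span {a} := by
      intro r hr
      obtain ⟨s, hs⟩ := Ideal.mem_span_singleton.mp hr
      have hrg : r * g ∈ Γ := Γ.smul_mem r hg
      have h0 : r * g = 0 := by rw [hs] at hrg ⊢; exact hdisj _ hrg
      rw [← Ideal.Quotient.eq_zero_iff_mem]
      have hz : (Ideal.Quotient.mk (Ideal.span {a}) r) • B i = 0 := by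
        apply Subtype.ext
        rw [Submodule.coe_smul, aux_smul]
        apply aux_ext
        rw [LinearMap.smul_apply, h]
        have : r • (Ideal.Quotient.mk (Ideal.span {b}) g) = Ideal.Quotient.mk (Ideal.span {b}) (r * g) := rfl
        rw [this, h0, map_zero]; rfl
      have := congrArg (fun v => B.repr v i) hz
      simpa using this
    obtain ⟨k, hk⟩ := hg
    have hgk : g ^ k ∈ Ideal.span {a} := by
      apply key
      have := hk (g ^ k) (Ideal.pow_mem_pow (hΓm g ⟨k, hk⟩) k)
      rw [smul_eq_mul] at this
      rw [this]; exact Ideal.zero_mem _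
    have hall : ∀ j, g ^ j ∈ Ideal.span {a} → False := by
      intro j
      induction j with
      | zero => intro h; exact hane ((Ideal.eq_top_iff_one _).mpr (by simpa using h))
      | succ j ih => intro h; exact ih (key _ (by rwa [← pow_succ]))
    exact hall k hgk
  refine ⟨⟨X, Y, hXne, hYne, hcompl⟩, ⟨X, Y, hXne, hYne, hcompl, hXfree⟩, fun hfree => hXfree ?_⟩
  have hfin : Module.Finite (R ⧸ Ideal.span {a}) ((R ⧸ Ideal.span {a}) →ₗ[R] (R ⧸ (Ideal.span {b}))) :=
    Module.Finite.of_restrictScalars_finite R _ _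
  exact aux_free hcompl
end

section
/- Let R be a commutative Noetherian local ring and M a finitely generated R-module of dimension d that is not Cohen-Macaulay. Then for any system of parameters a_1, …, a_d of M there exist positive integers n_1, …, n_d such that the R-module Hom_R(R/(a_1, …, a_d), M/(a_1^{n_1}, …, a_d^{n_d})M) is decomposable. -/
lemma aux_exists_killed {R Q : Type*} [CommRing R] [AddCommGroup Q] [Module R Q]
    (I : Ideal R) (l : ℕ) (hl : ∀ r ∈ I ^ l, ∀ q : Q, r • q = 0)
    (X : Submodule R Q) (hX : X ≠ ⊥) :
    ∃ x ∈ X, x ≠ 0 ∧ ∀ r ∈ I, r • x = 0 := by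
  obtain ⟨x, hx, hx0⟩ := X.ne_bot_iff.mp hX
  have hex : ∃ l : ℕ, ∀ r ∈ I ^ l, r • x = 0 := ⟨l, fun r hr => hl r hr x⟩
  classical
  have hsp := Nat.find_spec hex
  have hmin := fun m => @Nat.find_min _ _ hex m
  generalize Nat.find hex = k at hsp hmin
  rcases k with _ | k
  · exact absurd (by simpa using hsp 1 (by simp)) hx0
  · have := hmin k (Nat.lt_succ_self k)
    push Not at this
    obtain ⟨r, hr, hrx⟩ := this
    refine ⟨r • x, X.smul_mem r hx, hrx, fun s hs => ?_⟩
    rw [smul_smul]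
    exact hsp _ (by rw [pow_succ']; exact Ideal.mul_mem_mul hs hr)

/-- hom from quotient given by a killed element -/
noncomputable def auxHom {R Q : Type*} [CommRing R] [AddCommGroup Q] [Module R Q]
    (I : Ideal R) (q : Q) (hq : ∀ r ∈ I, r • q = 0) : (R ⧸ I) →ₗ[R] Q :=
  Submodule.liftQ I (LinearMap.toSpanSingleton R Q q) (fun r hr => by simpa using hq r hr)

lemma auxHom_one {R Q : Type*} [CommRing R] [AddCommGroup Q] [Module R Q]
    (I : Ideal R) (q : Q) (hq : ∀ r ∈ I, r • q = 0) : auxHom I q hq 1 = q := by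
  have : auxHom I q hq (Submodule.Quotient.mk (1 : R)) = q := by
    simp only [auxHom, Submodule.liftQ_apply]
    simp
  exact this

lemma aux_hom_ext {R Q : Type*} [CommRing R] [AddCommGroup Q] [Module R Q]
    (I : Ideal R) (f g : (R ⧸ I) →ₗ[R] Q) (h : f 1 = g 1) : f = g := by
  refine LinearMap.ext fun x => ?_
  obtain ⟨r, rfl⟩ := Ideal.Quotient.mk_surjective x
  have : (Ideal.Quotient.mk I r) = r • (1 : R ⧸ I) := by
    rw [Algebra.smul_def, mul_one]; rfl
  rw [this, map_smul, map_smul, h]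

lemma aux_decomp {R Q : Type*} [CommRing R] [AddCommGroup Q] [Module R Q]
    (I : Ideal R) (l : ℕ) (hl : ∀ r ∈ I ^ l, ∀ q : Q, r • q = 0)
    (X Y : Submodule R Q) (hX : X ≠ ⊥) (hY : Y ≠ ⊥) (hd : Disjoint X Y)
    (hs : ∀ q : Q, (∀ r ∈ I, r • q = 0) → q ∈ X ⊔ Y) :
    IsDecomposable R ((R ⧸ I) →ₗ[R] Q) := by
  have key : ∀ Z : Submodule R Q, Z ≠ ⊥ →
      Z.comap (LinearMap.applyₗ (R := R) (M := R ⧸ I) (M₂ := Q) 1) ≠ ⊥ := by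
    intro Z hZ
    obtain ⟨x, hx, hx0, hk⟩ := aux_exists_killed I l hl Z hZ
    rw [Submodule.ne_bot_iff]
    refine ⟨auxHom I x hk, ?_, fun h => hx0 ?_⟩
    · rw [Submodule.mem_comap, LinearMap.applyₗ_apply_apply, auxHom_one]; exact hx
    · rw [← auxHom_one I x hk, h]; rfl
  refine ⟨_, _, key X hX, key Y hY, ?_, ?_⟩
  · rw [Submodule.disjoint_def]
    intro f hf1 hf2
    exact aux_hom_ext I _ _ (Submodule.disjoint_def.mp hd _ hf1 hf2)
  · rw [codisjoint_iff, eq_top_iff]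
    intro f _
    have hf : ∀ r ∈ I, r • f 1 = 0 := by
      intro r hr
      have := @homIsTorsion _ _ I Q _ _ f ⟨r, hr⟩
      exact congrArg (fun g : (R ⧸ I) →ₗ[R] Q => g 1) this
    obtain ⟨x, hx, y, hy, hxy⟩ := Submodule.mem_sup.mp (hs _ hf)
    have hx' : ∀ r ∈ I, r • x = 0 := by
      intro r hr
      refine Submodule.disjoint_def.mp hd _ (X.smul_mem r hx) ?_
      have h1 : r • x = -(r • y) := by
        rw [eq_neg_iff_add_eq_zero, ← smul_add, hxy, hf r hr]
      rw [h1]; exact Y.neg_mem (Y.smul_mem r hy)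
    have hy' : ∀ r ∈ I, r • y = 0 := by
      intro r hr
      have := hf r hr
      rwa [← hxy, smul_add, hx' r hr, zero_add] at this
    refine Submodule.mem_sup.mpr ⟨auxHom I x hx', ?_, auxHom I y hy', ?_, ?_⟩
    · rw [Submodule.mem_comap, LinearMap.applyₗ_apply_apply, auxHom_one]; exact hx
    · rw [Submodule.mem_comap, LinearMap.applyₗ_apply_apply, auxHom_one]; exact hy
    · apply aux_hom_ext
      rw [LinearMap.add_apply, auxHom_one, auxHom_one, hxy]

lemma aux_one_dim {R N : Type*} [CommRing R] [IsNoetherianRing R]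
    [IsLocalRing R] [AddCommGroup N] [Module R N] [Module.Finite R N]
    (b : R) (hb : b ∈ nonunits R) (x : N) (hx : x ≠ 0) (hbx : b • x = 0)
    (hne : ∀ k : ℕ, ∃ y : N, b ^ k • y ≠ 0) :
    ∃ k : ℕ, 0 < k ∧ ∀ (Q : Type _) [AddCommGroup Q] [Module R Q] (π : N →ₗ[R] Q),
      Function.Surjective π → (∀ y, π y = 0 ↔ ∃ z, y = b ^ k • z) →
      ∃ X Y : Submodule R Q, X ≠ ⊥ ∧ Y ≠ ⊥ ∧ Disjoint X Y ∧
        ∀ q : Q, b • q = 0 → q ∈ X ⊔ Y := by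
  obtain ⟨k, hk, hk1⟩ := ((Module.End.eventually_disjoint_ker_pow_range_pow
    (LinearMap.lsmul R N b : Module.End R N)).and (Filter.eventually_ge_atTop 1)).exists
  have hpow : ∀ (m : ℕ) (y : N), ((LinearMap.lsmul R N b : Module.End R N) ^ m) y = b ^ m • y := by
    intro m y
    induction m with
    | zero => simp
    | succ m ih => rw [pow_succ', Module.End.mul_apply, ih, pow_succ', mul_smul]; rfl
  have hdis : ∀ t z : N, b • t = 0 → t = b ^ k • z → t = 0 := by
    intro t z ht htz
    refine Submodule.disjoint_def.mp hk t ?_ ⟨z, ?_⟩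
    · obtain ⟨k, rfl⟩ := Nat.exists_eq_add_of_le' hk1
      rw [LinearMap.mem_ker, hpow, pow_succ, mul_smul, ht, smul_zero]
    · rw [hpow, htz]
  refine ⟨k + 1, Nat.succ_pos k, fun Q _ _ π hπ hker => ?_⟩
  refine ⟨(LinearMap.ker (LinearMap.lsmul R N b)).map π,
    (LinearMap.range (LinearMap.lsmul R N (b ^ k))).map π, ?_, ?_, ?_, ?_⟩
  · rw [Submodule.ne_bot_iff]
    refine ⟨π x, ⟨x, by simpa using hbx, rfl⟩, fun h => hx ?_⟩
    obtain ⟨z, hz⟩ := (hker x).mp h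
    exact hdis x (b • z) hbx (by rw [hz, pow_succ, mul_smul])
  · intro hbot
    have hle : LinearMap.range (LinearMap.lsmul R N (b ^ k)) ≤
        Ideal.span {b} • LinearMap.range (LinearMap.lsmul R N (b ^ k)) := by
      rintro y hy
      have : π y = 0 := by
        rw [← Submodule.mem_bot R, ← hbot]; exact ⟨y, hy, rfl⟩
      obtain ⟨z, rfl⟩ := (hker y).mp this
      rw [pow_succ', mul_smul]
      exact Submodule.smul_mem_smul (Ideal.mem_span_singleton_self b) ⟨z, rfl⟩
    have := Submodule.eq_bot_of_le_smul_of_le_jacobson_bot _ _ (IsNoetherian.noetherian _) hle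
      (by
        rw [IsLocalRing.jacobson_eq_maximalIdeal ⊥ bot_ne_top, Ideal.span_singleton_le_iff_mem]
        exact hb)
    obtain ⟨y, hy⟩ := hne k
    apply hy
    rw [← Submodule.mem_bot R, ← this]
    exact ⟨y, rfl⟩
  · rw [Submodule.disjoint_def]
    rintro q ⟨t, ht, rfl⟩ ⟨_, ⟨z, rfl⟩, hz⟩
    have h0 : π (t - b ^ k • z) = 0 := by
      rw [map_sub, sub_eq_zero]; exact hz.symm
    obtain ⟨w, hw⟩ := (hker _).mp h0
    have : t = 0 := by
      refine hdis t (z + b • w) (by simpa using ht) ?_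
      rw [smul_add, smul_smul, ← pow_succ, ← hw]; abel
    rw [this, map_zero]
  · intro q hq
    obtain ⟨y, rfl⟩ := hπ q
    rw [← map_smul] at hq
    obtain ⟨z, hz⟩ := (hker _).mp hq
    refine Submodule.mem_sup.mpr ⟨π (y - b ^ k • z), ⟨_, ?_, rfl⟩, π (b ^ k • z),
      ⟨_, ⟨z, rfl⟩, rfl⟩, by rw [← map_add, sub_add_cancel]⟩
    simp only [SetLike.mem_coe, LinearMap.mem_ker, LinearMap.lsmul_apply]
    rw [smul_sub, hz, smul_smul, ← pow_succ', sub_self]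

lemma aux_pow_kill {R Q : Type*} [CommRing R] [IsNoetherianRing R]
    [IsLocalRing R] [AddCommGroup Q] [Module R Q] [Module.Finite R Q]
    (h : IsFiniteLength R Q) :
    ∃ l : ℕ, IsLocalRing.maximalIdeal R ^ l ≤ Module.annihilator R Q := by
  have hart := (isFiniteLength_iff_isNoetherian_isArtinian.mp h).2
  obtain ⟨n, hn⟩ := IsArtinian.monotone_stabilizes (R := R) (M := Q)
    ⟨fun n => OrderDual.toDual (IsLocalRing.maximalIdeal R ^ n • (⊤ : Submodule R Q)),
      fun m n hmn => Submodule.smul_mono_left (Ideal.pow_le_pow_right hmn)⟩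
  refine ⟨n, fun r hr => ?_⟩
  rw [Module.mem_annihilator]
  intro q
  have h0 := Ideal.iInf_pow_smul_eq_bot_of_isLocalRing (M := Q) (IsLocalRing.maximalIdeal R)
    Ideal.IsPrime.ne_top'
  rw [← Submodule.mem_bot R, ← h0, Submodule.mem_iInf]
  intro i
  have hmem : r • q ∈ IsLocalRing.maximalIdeal R ^ n • (⊤ : Submodule R Q) :=
    Submodule.smul_mem_smul hr trivial
  rcases le_total n i with h | h
  · have := hn i h
    have h2 : IsLocalRing.maximalIdeal R ^ n • (⊤ : Submodule R Q) =
      IsLocalRing.maximalIdeal R ^ i • (⊤ : Submodule R Q) := this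
    rwa [← h2]
  · exact Submodule.smul_mono_left (Ideal.pow_le_pow_right h) hmem

lemma aux_dim_s9 {R M : Type*} [CommRing R] [IsNoetherianRing R]
    [IsLocalRing R] [AddCommGroup M] [Module R M] [Module.Finite R M]
    (d : ℕ) (a : Fin d → R) (ha : IsSystemOfParameters R M a) (i : Fin d) (n : Fin d → ℕ)
    (hn : ∀ j, 0 < n j) (k : ℕ)
    (hk : ∀ x : M, a i ^ k • x ∈
      Ideal.span ((fun j => a j ^ n j) '' {j | j ≠ i}) • (⊤ : Submodule R M)) : False := by
  obtain ⟨hu, hdim, hfl⟩ := ha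
  set J := Ideal.span ((fun j => a j ^ n j) '' {j | j ≠ i}) with hJ
  have hnt : Nontrivial (R ⧸ Module.annihilator R M) := by
    by_contra h
    rw [not_nontrivial_iff_subsingleton] at h
    rw [moduleDim, ringKrullDim_eq_bot_of_subsingleton] at hdim
    exact absurd hdim.symm (by simp)
  have hloc : IsLocalRing (R ⧸ Module.annihilator R M) :=
    .of_surjective' (Ideal.Quotient.mk _) Ideal.Quotient.mk_surjective
  obtain ⟨l, hl⟩ := aux_pow_kill hfl
  have hprime : ∀ p : Ideal R, p.IsPrime → J ≤ p → Module.annihilator R M ≤ p →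
      p = IsLocalRing.maximalIdeal R := by
    intro p hp hJp hAp
    have hpM : (⟨p, hp⟩ : PrimeSpectrum R) ∈ Module.support R M :=
      Module.mem_support_iff_of_finite.mpr hAp
    have hpN : (⟨p, hp⟩ : PrimeSpectrum R) ∈
        Module.support R (M ⧸ (J • (⊤ : Submodule R M))) := by
      rw [Module.support_quotient]
      exact ⟨hpM, hJp⟩
    have hai : a i ∈ p := by
      refine hp.mem_of_pow_mem k (Module.mem_support_iff_of_finite.mp hpN ?_)
      rw [Module.mem_annihilator]
      intro q
      obtain ⟨x, rfl⟩ := Submodule.Quotient.mk_surjective _ q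
      rw [← Submodule.Quotient.mk_smul, Submodule.Quotient.mk_eq_zero]
      exact hk x
    have hIp : Ideal.span (Set.range a) ≤ p := by
      rw [Ideal.span_le]
      rintro _ ⟨j, rfl⟩
      by_cases hj : j = i
      · rw [hj]; exact hai
      · exact hp.mem_of_pow_mem (n j) (hJp (Ideal.subset_span ⟨j, hj, rfl⟩))
    have hpQ : (⟨p, hp⟩ : PrimeSpectrum R) ∈
        Module.support R (M ⧸ (Ideal.span (Set.range a) • (⊤ : Submodule R M))) := by
      rw [Module.support_quotient]
      exact ⟨hpM, hIp⟩
    have h1 := hl.trans (Module.mem_support_iff_of_finite.mp hpQ)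
    have h2 := hp.le_of_pow_le h1
    exact ((IsLocalRing.maximalIdeal.isMaximal R).eq_of_le hp.ne_top h2).symm
  classical
  let s : Finset (R ⧸ Module.annihilator R M) :=
    (Finset.univ.erase i).image fun j => Ideal.Quotient.mk _ (a j ^ n j)
  have hcard : s.card ≤ d - 1 := by
    refine Finset.card_image_le.trans ?_
    simp
  have hs : ∀ P : Ideal (R ⧸ Module.annihilator R M), P.IsPrime → Ideal.span (s : Set _) ≤ P →
      P = IsLocalRing.maximalIdeal _ := by
    intro P hP hsP
    have h1 := hprime (P.comap (Ideal.Quotient.mk _)) (hP.comap _) ?_ ?_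
    · refine le_antisymm (IsLocalRing.le_maximalIdeal hP.ne_top) ?_
      intro y hy
      obtain ⟨r, rfl⟩ := Ideal.Quotient.mk_surjective y
      have hr : r ∈ IsLocalRing.maximalIdeal R := by
        rw [IsLocalRing.mem_maximalIdeal, mem_nonunits_iff] at hy ⊢
        exact fun hr => hy (hr.map _)
      rw [← h1] at hr
      exact hr
    · rw [hJ, Ideal.span_le]
      rintro _ ⟨j, hj, rfl⟩
      refine hsP (Ideal.subset_span ?_)
      simp only [s, Finset.coe_image]
      exact ⟨j, by simpa using hj, rfl⟩
    · intro r hr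
      rw [Ideal.mem_comap, Ideal.Quotient.eq_zero_iff_mem.mpr hr]
      exact P.zero_mem
  by_cases hlem : Ideal.span (s : Set _) ≤ IsLocalRing.maximalIdeal (R ⧸ Module.annihilator R M)
  · have hmin : IsLocalRing.maximalIdeal (R ⧸ Module.annihilator R M) ∈
        (Ideal.span (s : Set _)).minimalPrimes :=
      ⟨⟨inferInstance, hlem⟩, fun P hP _ => (hs P hP.1 hP.2).ge⟩
    have h1 := Ideal.height_le_card_of_mem_minimalPrimes_span_finset hmin
    have h2 := IsLocalRing.maximalIdeal_height_eq_ringKrullDim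
      (R := R ⧸ Module.annihilator R M)
    rw [moduleDim] at hdim
    rw [hdim] at h2
    have h3 : (IsLocalRing.maximalIdeal (R ⧸ Module.annihilator R M)).height = (d : ℕ∞) := by
      exact_mod_cast h2
    rw [h3] at h1
    have h4 : d ≤ s.card := by exact_mod_cast h1
    have := i.pos
    omega
  · apply hlem
    rw [Ideal.span_le]
    intro y hy
    simp only [s, Finset.coe_image] at hy
    obtain ⟨j, -, rfl⟩ := hy
    have hj : Ideal.Quotient.mk (Module.annihilator R M) (a j) ∈
        IsLocalRing.maximalIdeal (R ⧸ Module.annihilator R M) := by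
      rw [IsLocalRing.mem_maximalIdeal, mem_nonunits_iff]
      intro hunit
      obtain ⟨v, hv⟩ := hunit.exists_right_inv
      obtain ⟨v, rfl⟩ := Ideal.Quotient.mk_surjective v
      rw [← map_mul, ← map_one (Ideal.Quotient.mk _), Ideal.Quotient.eq] at hv
      have hA : Module.annihilator R M ≤ IsLocalRing.maximalIdeal R :=
        IsLocalRing.le_maximalIdeal (Ideal.Quotient.nontrivial_iff.mp hnt)
      have h1 : a j * v ∈ IsLocalRing.maximalIdeal R := Ideal.mul_mem_right _ _ (hu j)
      have h2 := (IsLocalRing.maximalIdeal R).sub_mem h1 (hA hv)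
      rw [sub_sub_cancel] at h2
      exact h2 isUnit_one
    simp only [map_pow]
    exact Ideal.pow_mem_of_mem _ hj _ (hn j)

lemma aux_not_regular {R M : Type*} [CommRing R] [IsNoetherianRing R]
    [IsLocalRing R] [AddCommGroup M] [Module R M] [Module.Finite R M]
    (d : ℕ) (hM : ¬ IsCohenMacaulay R M) (a : Fin d → R) (ha : IsSystemOfParameters R M a) :
    ∃ (i : Fin d) (x : M), x ∉ Ideal.span (a '' {j | j < i}) • (⊤ : Submodule R M) ∧
      a i • x ∈ Ideal.span (a '' {j | j < i}) • (⊤ : Submodule R M) := by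
  obtain ⟨hu, hdim, hfl⟩ := ha
  by_contra! hcon
  have hsd : Module.supportDim R M = (d : ℕ∞) := by
    rw [Module.supportDim_eq_ringKrullDim_quotient_annihilator]; exact hdim
  have hnt : Nontrivial M := by
    rw [← Module.supportDim_ne_bot_iff_nontrivial R, hsd]
    simp
  apply hM
  rw [IsCohenMacaulay, hdim]
  refine congrArg _ (le_antisymm ?_ ?_)
  · refine sSup_le ?_
    rintro _ ⟨rs, rfl, -, hreg⟩
    have h1 := Module.supportDim_add_length_eq_supportDim_of_isRegular rs hreg
    rw [hsd] at h1
    have hq : Nontrivial (M ⧸ Ideal.ofList rs • (⊤ : Submodule R M)) :=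
      Submodule.Quotient.nontrivial_iff.mpr hreg.2.symm
    have h2 := (Module.supportDim_ne_bot_iff_nontrivial R
      (M ⧸ Ideal.ofList rs • (⊤ : Submodule R M))).mpr hq
    obtain ⟨e, he⟩ := WithBot.ne_bot_iff_exists.mp h2
    rw [← he] at h1
    have h3 : e + (rs.length : ℕ∞) = (d : ℕ∞) := by exact_mod_cast h1
    rw [← h3]
    exact le_add_self
  · refine le_sSup ⟨List.ofFn a, by simp, ?_, ⟨?_⟩, ?_⟩
    · intro r hr
      obtain ⟨j, rfl⟩ := (List.mem_ofFn' _ _).mp hr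
      exact hu j
    · intro i hi
      have hi' : i < d := by simpa using hi
      have hget : (List.ofFn a)[i] = a ⟨i, hi'⟩ := by simp
      have hof : Ideal.ofList ((List.ofFn a).take i) = Ideal.span (a '' {j | j < ⟨i, hi'⟩}) := by
        rw [Ideal.ofList]
        congr 1
        ext r
        simp only [Set.mem_setOf_eq, Set.mem_image, List.mem_take_iff_getElem]
        constructor
        · rintro ⟨j, hj, rfl⟩
          have hj' : j < i := lt_of_lt_of_le hj (min_le_left _ _)
          exact ⟨⟨j, hj'.trans hi'⟩, hj', by simp⟩
        · rintro ⟨j, hj, rfl⟩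
          have hj' : (j : ℕ) < i := hj
          exact ⟨j, by simp [hj'], by simp⟩
      rw [hget, hof, isSMulRegular_iff_right_eq_zero_of_smul]
      intro q hq
      obtain ⟨x, rfl⟩ := Submodule.Quotient.mk_surjective _ q
      rw [← Submodule.Quotient.mk_smul, Submodule.Quotient.mk_eq_zero] at hq
      rw [Submodule.Quotient.mk_eq_zero]
      by_contra hx
      exact hcon _ x hx hq
    · intro htop
      have hle : Ideal.ofList (List.ofFn a) ≤ IsLocalRing.maximalIdeal R := by
        rw [Ideal.ofList, Ideal.span_le]
        intro r hr
        obtain ⟨j, rfl⟩ := (List.mem_ofFn' _ _).mp hr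
        exact hu j
      have := Submodule.eq_bot_of_le_smul_of_le_jacobson_bot _ _ (IsNoetherian.noetherian _)
        htop.le (hle.trans (IsLocalRing.maximalIdeal_le_jacobson _))
      exact top_ne_bot this

/-- Theorem 4.1. If `M` is a non-Cohen-Macaulay finitely generated module
of dimension `d` over a Noetherian local ring, then for any system of parameters
`a₁, …, a_d` of `M` there are positive integers `n₁, …, n_d` such that the `R`-module
`Hom_R(R/(a₁, …, a_d), M/(a₁^{n₁}, …, a_d^{n_d})M)` is decomposable. -/
theorem isDecomposable_hom_higher_dim {R M : Type*} [CommRing R] [IsNoetherianRing R]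
    [IsLocalRing R] [AddCommGroup M] [Module R M] [Module.Finite R M]
    (d : ℕ) (hdim : moduleDim R M = (d : WithBot ℕ∞))
    (hM : ¬ IsCohenMacaulay R M) (a : Fin d → R) (ha : IsSystemOfParameters R M a) :
    ∃ n : Fin d → ℕ, (∀ i, 0 < n i) ∧
      IsDecomposable R ((R ⧸ Ideal.span (Set.range a)) →ₗ[R]
        (M ⧸ (Ideal.span (Set.range fun i => a i ^ n i) • (⊤ : Submodule R M)))) := by
  classical
  have hu := ha.1
  obtain ⟨i, x, hx, hix⟩ := aux_not_regular d hM a ha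
  set K0 := Ideal.span (a '' {j | j < i}) • (⊤ : Submodule R M) with hK0
  -- Krull intersection
  obtain ⟨e, he⟩ : ∃ e : ℕ, (Submodule.Quotient.mk x : M ⧸ K0) ∉
      IsLocalRing.maximalIdeal R ^ e • (⊤ : Submodule R (M ⧸ K0)) := by
    by_contra! h
    apply hx
    rw [← Submodule.Quotient.mk_eq_zero, ← Submodule.mem_bot R,
      ← Ideal.iInf_pow_smul_eq_bot_of_isLocalRing (M := M ⧸ K0) (IsLocalRing.maximalIdeal R)
        Ideal.IsPrime.ne_top', Submodule.mem_iInf]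
    exact h
  let n : Fin d → ℕ := fun j => if j < i then 1 else e + 1
  have hn : ∀ j, 0 < n j := fun j => by
    by_cases h : j < i <;> simp [n, h]
  set J := Ideal.span ((fun j => a j ^ n j) '' {j | j ≠ i}) with hJ
  have hK0J : K0 ≤ J • (⊤ : Submodule R M) := by
    refine Submodule.smul_mono_left (Ideal.span_le.mpr ?_)
    rintro _ ⟨j, hj, rfl⟩
    have hj' : j < i := hj
    exact Ideal.subset_span ⟨j, hj'.ne, by simp [n, hj']⟩
  have hxJ : x ∉ J • (⊤ : Submodule R M) := by
    intro h
    apply he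
    have hle : J • (⊤ : Submodule R M) ≤
        (IsLocalRing.maximalIdeal R ^ e • (⊤ : Submodule R (M ⧸ K0))).comap K0.mkQ := by
      rw [Submodule.smul_le]
      intro r hr y _
      induction hr using Submodule.span_induction with
      | mem r hr =>
        obtain ⟨j, hj, rfl⟩ := hr
        by_cases hji : j < i
        · have h0 : K0.mkQ (a j • y) = 0 := by
            rw [Submodule.mkQ_apply, Submodule.Quotient.mk_eq_zero]
            exact Submodule.smul_mem_smul (Ideal.subset_span ⟨j, hji, rfl⟩) trivial
          simp only [n, hji, if_true, pow_one, Submodule.mem_comap]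
          rw [h0]; exact Submodule.zero_mem _
        · rw [Submodule.mem_comap, map_smul]
          refine Submodule.smul_mem_smul ?_ trivial
          simp only [n, hji, if_false]
          exact Ideal.pow_le_pow_right (Nat.le_succ e) (Ideal.pow_mem_pow (hu j) _)
      | zero => rw [zero_smul]; exact Submodule.zero_mem _
      | add r s _ _ h1 h2 => rw [add_smul]; exact Submodule.add_mem _ h1 h2
      | smul c r _ h1 => rw [smul_assoc]; exact Submodule.smul_mem _ _ h1
    exact hle h
  obtain ⟨k, hk, H⟩ := aux_one_dim (N := M ⧸ (J • (⊤ : Submodule R M))) (a i) (hu i)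
    (Submodule.Quotient.mk x) (by rwa [Ne, Submodule.Quotient.mk_eq_zero])
    (by rw [← Submodule.Quotient.mk_smul, Submodule.Quotient.mk_eq_zero]; exact hK0J hix)
    (by
      intro k
      by_contra! h
      refine aux_dim_s9 d a ha i n hn k fun y => ?_
      have := h (Submodule.Quotient.mk y)
      rwa [← Submodule.Quotient.mk_smul, Submodule.Quotient.mk_eq_zero] at this)
  let n' : Fin d → ℕ := Function.update n i k
  have hn' : ∀ j, 0 < n' j := by
    intro j
    by_cases hj : j = i
    · subst hj; simpa [n'] using hk
    · simpa [n', hj] using hn j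
  refine ⟨n', hn', ?_⟩
  set L := Ideal.span (Set.range fun j => a j ^ n' j) with hL
  have hLJ : L = Ideal.span {a i ^ k} ⊔ J := by
    rw [hL, hJ, ← Ideal.span_union]
    congr 1
    ext r
    simp only [Set.mem_range, Set.mem_union, Set.mem_singleton_iff, Set.mem_image,
      Set.mem_setOf_eq]
    constructor
    · rintro ⟨j, rfl⟩
      by_cases hj : j = i
      · subst hj; left; simp [n']
      · right; exact ⟨j, hj, by simp [n', hj]⟩
    · rintro (rfl | ⟨j, hj, rfl⟩)
      · exact ⟨i, by simp [n']⟩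
      · exact ⟨j, by simp [n', hj]⟩
  have hJL : J • (⊤ : Submodule R M) ≤ L • (⊤ : Submodule R M) :=
    Submodule.smul_mono_left (hLJ ▸ le_sup_right)
  obtain ⟨X, Y, hX, hY, hd, hs⟩ := H (M ⧸ (L • (⊤ : Submodule R M)))
    (Submodule.factor hJL) (Submodule.factor_surjective hJL) (by
      intro y
      obtain ⟨y, rfl⟩ := Submodule.Quotient.mk_surjective _ y
      have : Submodule.factor hJL (Submodule.Quotient.mk y) = Submodule.Quotient.mk y := rfl
      rw [this, Submodule.Quotient.mk_eq_zero, hLJ, Submodule.sup_smul, Submodule.mem_sup]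
      constructor
      · rintro ⟨u, hu, v, hv, rfl⟩
        rw [Submodule.ideal_span_singleton_smul] at hu
        obtain ⟨z, -, rfl⟩ := hu
        refine ⟨Submodule.Quotient.mk z, ?_⟩
        rw [← Submodule.Quotient.mk_smul, Submodule.Quotient.eq]
        simpa using hv
      · rintro ⟨z, hz⟩
        obtain ⟨z, rfl⟩ := Submodule.Quotient.mk_surjective _ z
        rw [← Submodule.Quotient.mk_smul, Submodule.Quotient.eq] at hz
        exact ⟨_, Submodule.smul_mem_smul (Ideal.mem_span_singleton_self _) trivial, _, hz,
          add_sub_cancel _ _⟩)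
  obtain ⟨l, hl⟩ : ∃ l, Ideal.span (Set.range a) ^ l ≤ L := by
    refine Ideal.exists_pow_le_of_le_radical_of_fg ?_ (IsNoetherian.noetherian _)
    rw [Ideal.span_le]
    rintro _ ⟨j, rfl⟩
    exact ⟨n' j, Ideal.subset_span ⟨j, rfl⟩⟩
  refine aux_decomp _ l ?_ X Y hX hY hd ?_
  · intro r hr q
    obtain ⟨y, rfl⟩ := Submodule.Quotient.mk_surjective _ q
    rw [← Submodule.Quotient.mk_smul, Submodule.Quotient.mk_eq_zero]
    exact Submodule.smul_mem_smul (hl hr) trivial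
  · intro q hq
    exact hs q (hq _ (Ideal.subset_span ⟨i, rfl⟩))
end

section
/- Let R be a commutative Noetherian local ring of dimension d that is not Cohen-Macaulay. Then for any system of parameters a_1, …, a_d of R there exist positive integers n_1, …, n_d, N_1, …, N_d with n_i ≤ N_i for each i such that the R/(a_1^{n_1}, …, a_d^{n_d})-module Hom_R(R/(a_1^{n_1}, …, a_d^{n_d}), R/(a_1^{N_1}, …, a_d^{N_d})) is decomposable and not free. -/
theorem aux_free_summand {A H : Type*} [CommRing A] [IsLocalRing A] [AddCommGroup H] [Module A H]
    [Module.Finite A H] [Module.Free A H] (X Y : Submodule A H) (hX : X ≠ ⊥) (hc : IsCompl X Y)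
    (c : A) (hcX : ∀ x ∈ X, c • x = 0) : c = 0 := by
  have hproj : Module.Projective A X :=
    Module.Projective.of_split X.subtype (X.projectionOnto Y hc)
      (by ext x; simp)
  have hfin : Module.Finite A X := Module.Finite.of_surjective (X.projectionOnto Y hc)
    (fun x => ⟨x, by simp⟩)
  have hfree : Module.Free A X := Module.free_of_flat_of_isLocalRing
  have : Nontrivial X := Submodule.nontrivial_iff_ne_bot.mpr hX
  let b := Module.Free.chooseBasis A X
  have hne : Nonempty (Module.Free.ChooseBasisIndex A X) := b.index_nonempty
  obtain ⟨i⟩ := hne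
  have h1 : c • b i = 0 := Subtype.ext (hcX _ (b i).2)
  have h2 := congrArg (fun v => b.repr v i) h1
  simpa using h2

theorem aux_core {R : Type*} [CommRing R] [IsNoetherianRing R] [IsLocalRing R]
    (J : Ideal R) (b : R) (hb : b ∈ nonunits R) (hnil : ∀ m, b ^ m ∉ J) (x₀ : R)
    (hx₀ : b * x₀ ∈ J) (hx₀' : x₀ ∉ J) (k : ℕ) (hk0 : 0 < k)
    (hk : ∀ m x, b ^ m * x ∈ J → b ^ k * x ∈ J) (I I' : Ideal R)
    (hI : I = J ⊔ Ideal.span {b ^ (k + 1)}) (hI' : I' = J ⊔ Ideal.span {b ^ (2 * (k + 1))}) :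
    letI := quotHomModule I (R ⧸ I')
    IsDecomposable (R ⧸ I) ((R ⧸ I) →ₗ[R] (R ⧸ I')) ∧
      ¬ Module.Free (R ⧸ I) ((R ⧸ I) →ₗ[R] (R ⧸ I')) := by
  letI inst := quotHomModule I (R ⧸ I')
  have hsm : ∀ (r : R) (φ : (R ⧸ I) →ₗ[R] (R ⧸ I')), (Ideal.Quotient.mk I r) • φ = r • φ :=
    fun r φ => rfl
  have hbm : ∀ z, IsUnit (1 - b * z) := fun z => by
    apply IsLocalRing.isUnit_one_sub_self_of_mem_nonunits
    exact Ideal.mul_mem_right (I := IsLocalRing.maximalIdeal R) z hb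
  have memI : ∀ x, x ∈ I ↔ ∃ z, x - b ^ (k + 1) * z ∈ J := fun x => by
    rw [hI, Submodule.mem_sup]
    constructor
    · rintro ⟨y, hy, z, hz, rfl⟩
      obtain ⟨w, rfl⟩ := Ideal.mem_span_singleton'.mp hz
      exact ⟨w, by convert hy using 1; ring⟩
    · rintro ⟨z, hz⟩
      exact ⟨_, hz, b ^ (k + 1) * z, Ideal.mem_span_singleton.mpr ⟨z, rfl⟩, by ring⟩
  have memI' : ∀ x, x ∈ I' ↔ ∃ z, x - b ^ (2 * (k + 1)) * z ∈ J := fun x => by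
    rw [hI', Submodule.mem_sup]
    constructor
    · rintro ⟨y, hy, z, hz, rfl⟩
      obtain ⟨w, rfl⟩ := Ideal.mem_span_singleton'.mp hz
      exact ⟨w, by convert hy using 1; ring⟩
    · rintro ⟨z, hz⟩
      exact ⟨_, hz, b ^ (2 * (k + 1)) * z, Ideal.mem_span_singleton.mpr ⟨z, rfl⟩, by ring⟩
  -- the hom with prescribed value
  have hmk : ∀ q : R, (b ^ (k + 1) * q ∈ I') → ∃ φ : (R ⧸ I) →ₗ[R] (R ⧸ I'),
      φ (Ideal.Quotient.mk I 1) = Ideal.Quotient.mk I' q := fun q hq => by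
    refine ⟨Submodule.liftQ I (LinearMap.toSpanSingleton R (R ⧸ I') (Ideal.Quotient.mk I' q)) ?_, ?_⟩
    · intro x hx
      obtain ⟨z, hz⟩ := (memI x).mp hx
      rw [LinearMap.mem_ker, LinearMap.toSpanSingleton_apply]
      change Ideal.Quotient.mk I' (x * q) = 0
      rw [Ideal.Quotient.eq_zero_iff_mem]
      have hJ : J ≤ I' := by rw [hI']; exact le_sup_left
      have : x * q = q * (x - b ^ (k + 1) * z) + z * (b ^ (k + 1) * q) := by ring
      rw [this]
      exact I'.add_mem (I'.mul_mem_left _ (hJ hz)) (I'.mul_mem_left _ hq)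
    · change (1 : R) • (Ideal.Quotient.mk I' q) = _
      rw [one_smul]
  have hext : ∀ φ ψ : (R ⧸ I) →ₗ[R] (R ⧸ I'),
      φ (Ideal.Quotient.mk I 1) = ψ (Ideal.Quotient.mk I 1) → φ = ψ := fun φ ψ h => by
    refine LinearMap.ext fun x => ?_
    obtain ⟨r, rfl⟩ := Ideal.Quotient.mk_surjective x
    have : Ideal.Quotient.mk I r = r • Ideal.Quotient.mk I 1 := by
      change _ = Ideal.Quotient.mk I (r * 1)
      rw [mul_one]
    rw [this, map_smul, map_smul, h]
  have key : ∀ q w, b ^ k * q ∈ J → q - b ^ (k + 1) * w ∈ J → q ∈ J := fun q w h1 h2 => by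
    have h3 : b ^ (k + (k + 1)) * w ∈ J := by
      have : b ^ (k + (k + 1)) * w = b ^ k * q - b ^ k * (q - b ^ (k + 1) * w) := by ring
      rw [this]
      exact J.sub_mem h1 (J.mul_mem_left _ h2)
    have h4 := hk _ _ h3
    have : q = (q - b ^ (k + 1) * w) + b * (b ^ k * w) := by ring
    rw [this]
    exact J.add_mem h2 (J.mul_mem_left _ h4)
  let X : Submodule (R ⧸ I) ((R ⧸ I) →ₗ[R] (R ⧸ I')) :=
    { carrier := {φ | ∃ q, b ^ k * q ∈ J ∧ φ (Ideal.Quotient.mk I 1) = Ideal.Quotient.mk I' q}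
      zero_mem' := ⟨0, by simp, by simp⟩
      add_mem' := by
        rintro φ ψ ⟨q, hq, h⟩ ⟨q', hq', h'⟩
        exact ⟨q + q', by rw [mul_add]; exact J.add_mem hq hq', by
          rw [LinearMap.add_apply, h, h', map_add]⟩
      smul_mem' := by
        rintro c φ ⟨q, hq, h⟩
        obtain ⟨r, rfl⟩ := Ideal.Quotient.mk_surjective c
        refine ⟨r * q, by rw [mul_left_comm]; exact J.mul_mem_left _ hq, ?_⟩
        rw [hsm, LinearMap.smul_apply, h]; rfl }
  let Y : Submodule (R ⧸ I) ((R ⧸ I) →ₗ[R] (R ⧸ I')) :=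
    { carrier := {φ | ∃ q, φ (Ideal.Quotient.mk I 1) = Ideal.Quotient.mk I' (b ^ (k + 1) * q)}
      zero_mem' := ⟨0, by simp⟩
      add_mem' := by
        rintro φ ψ ⟨q, h⟩ ⟨q', h'⟩
        exact ⟨q + q', by rw [LinearMap.add_apply, h, h', mul_add, map_add]⟩
      smul_mem' := by
        rintro c φ ⟨q, h⟩
        obtain ⟨r, rfl⟩ := Ideal.Quotient.mk_surjective c
        refine ⟨r * q, ?_⟩
        rw [hsm, LinearMap.smul_apply, h, mul_left_comm]; rfl }
  have hXne : X ≠ ⊥ := by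
    have hq : b ^ k * x₀ ∈ J := hk 1 x₀ (by simpa using hx₀)
    obtain ⟨φ, hφ⟩ := hmk x₀ ((memI' _).mpr ⟨0, by
      have := J.mul_mem_left b hq
      convert this using 1; ring⟩)
    intro h
    have hφX : φ ∈ X := ⟨x₀, hq, hφ⟩
    rw [h, Submodule.mem_bot] at hφX
    rw [hφX, LinearMap.zero_apply, eq_comm, Ideal.Quotient.eq_zero_iff_mem, memI'] at hφ
    obtain ⟨z, hz⟩ := hφ
    exact hx₀' (key x₀ (b ^ (k + 1) * z) hq (by convert hz using 1; ring))
  have hYne : Y ≠ ⊥ := by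
    obtain ⟨φ, hφ⟩ := hmk (b ^ (k + 1) * 1) ((memI' _).mpr ⟨1, by
      convert J.zero_mem using 1; ring⟩)
    intro h
    have hφX : φ ∈ Y := ⟨1, hφ⟩
    rw [h, Submodule.mem_bot] at hφX
    rw [hφX, LinearMap.zero_apply, eq_comm, Ideal.Quotient.eq_zero_iff_mem, memI'] at hφ
    obtain ⟨z, hz⟩ := hφ
    have h1 : b ^ (k + 1) * (1 - b * (b ^ k * z)) ∈ J := by convert hz using 1; ring
    exact hnil _ ((Ideal.mul_unit_mem_iff_mem _ (hbm _)).mp h1)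
  have hcompl : IsCompl X Y := by
    constructor
    · rw [Submodule.disjoint_def]
      rintro φ ⟨q, hq, h⟩ ⟨w, h'⟩
      apply hext
      rw [LinearMap.zero_apply, h, Ideal.Quotient.eq_zero_iff_mem]
      rw [h, Ideal.Quotient.eq, memI'] at h'
      obtain ⟨z, hz⟩ := h'
      have := key q (w + b ^ (k + 1) * z) hq (by convert hz using 1; ring)
      rw [hI']; exact Submodule.mem_sup_left this
    · rw [codisjoint_iff, eq_top_iff]
      intro φ _
      obtain ⟨x, hx⟩ := Ideal.Quotient.mk_surjective (φ (Ideal.Quotient.mk I 1))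
      have h0 : b ^ (k + 1) * x ∈ I' := by
        rw [← Ideal.Quotient.eq_zero_iff_mem]
        change b ^ (k + 1) • Ideal.Quotient.mk I' x = 0
        rw [hx, ← map_smul]
        have : b ^ (k + 1) • Ideal.Quotient.mk I 1 = 0 := by
          change Ideal.Quotient.mk I (b ^ (k + 1) * 1) = 0
          rw [Ideal.Quotient.eq_zero_iff_mem, memI]
          exact ⟨1, by simp⟩
        rw [this, map_zero]
      obtain ⟨z, hz⟩ := (memI' _).mp h0
      have h1 : b ^ k * (x - b ^ (k + 1) * z) ∈ J := hk (k + 1) _ (by convert hz using 1; ring)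
      obtain ⟨φ₁, h₁⟩ := hmk (x - b ^ (k + 1) * z) ((memI' _).mpr ⟨0, by
        have := J.mul_mem_left b h1
        convert this using 1; ring⟩)
      obtain ⟨φ₂, h₂⟩ := hmk (b ^ (k + 1) * z) ((memI' _).mpr ⟨z, by
        convert J.zero_mem using 1; ring⟩)
      rw [Submodule.mem_sup]
      refine ⟨φ₁, ⟨_, h1, h₁⟩, φ₂, ⟨z, h₂⟩, ?_⟩
      apply hext
      rw [LinearMap.add_apply, h₁, h₂, ← map_add, sub_add_cancel, hx]
  refine ⟨⟨X, Y, hXne, hYne, hcompl⟩, fun hfree => ?_⟩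
  have hIne : I ≠ ⊤ := by
    intro h
    have h1 : (1 : R) ∈ I := by rw [h]; trivial
    obtain ⟨z, hz⟩ := (memI 1).mp h1
    have h2 : 1 * (1 - b * (b ^ k * z)) ∈ J := by convert hz using 1; ring
    exact hnil 0 (by simpa using (Ideal.mul_unit_mem_iff_mem _ (hbm _)).mp h2)
  have : Nontrivial (R ⧸ I) := Ideal.Quotient.nontrivial_iff.mpr hIne
  have : IsLocalRing (R ⧸ I) :=
    IsLocalRing.of_surjective' (Ideal.Quotient.mk I) Ideal.Quotient.mk_surjective
  have htow : IsScalarTower R (R ⧸ I) ((R ⧸ I) →ₗ[R] (R ⧸ I')) := 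
    ⟨fun r c φ => by
      obtain ⟨s, rfl⟩ := Ideal.Quotient.mk_surjective c
      change (Ideal.Quotient.mk I (r * s)) • φ = _
      rw [hsm, hsm, smul_smul]⟩
  have hfin : Module.Finite (R ⧸ I) ((R ⧸ I) →ₗ[R] (R ⧸ I')) :=
    Module.Finite.of_restrictScalars_finite R (R ⧸ I) _
  have h0 := aux_free_summand X Y hXne hcompl (Ideal.Quotient.mk I (b ^ k)) (by
    rintro φ ⟨q, hq, h⟩
    rw [hsm]
    apply hext
    rw [LinearMap.smul_apply, h]
    change Ideal.Quotient.mk I' (b ^ k * q) = 0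
    rw [Ideal.Quotient.eq_zero_iff_mem, hI']
    exact Submodule.mem_sup_left hq)
  rw [Ideal.Quotient.eq_zero_iff_mem, memI] at h0
  obtain ⟨z, hz⟩ := h0
  have h2 : b ^ k * (1 - b * z) ∈ J := by convert hz using 1; ring
  exact hnil k ((Ideal.mul_unit_mem_iff_mem _ (hbm _)).mp h2)

theorem aux_stab {R : Type*} [CommRing R] [IsNoetherianRing R] (J : Ideal R) (b : R) :
    ∃ k, 0 < k ∧ ∀ m x, b ^ m * x ∈ J → b ^ k * x ∈ J := by
  let f : ℕ →o Ideal R :=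
    { toFun := fun n => 
        { carrier := {x | b ^ n * x ∈ J}
          zero_mem' := by simp
          add_mem' := fun {x y} hx hy => by
            change b ^ n * (x + y) ∈ J
            rw [mul_add]; exact J.add_mem hx hy
          smul_mem' := fun c x hx => by
            change b ^ n * (c * x) ∈ J
            rw [mul_left_comm]; exact J.mul_mem_left _ hx }
      monotone' := fun n m h x hx => by
        change b ^ m * x ∈ J
        obtain ⟨l, rfl⟩ := Nat.exists_eq_add_of_le h
        rw [add_comm, pow_add, mul_assoc]
        exact J.mul_mem_left _ hx }
  obtain ⟨n, hn⟩ := monotone_stabilizes_iff_noetherian.mpr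
    (inferInstance : IsNoetherian R R) f
  refine ⟨n + 1, by omega, fun m x hx => ?_⟩
  have h1 : x ∈ f (max m n) := f.monotone (le_max_left m n) hx
  rw [← hn _ (le_max_right m n)] at h1
  exact f.monotone (Nat.le_succ n) h1

/-- The ideal generated by the powers of all but one of the parameters. -/
def auxJ {R : Type*} [CommRing R] {d : ℕ} (a : Fin d → R) (N : Fin d → ℕ) (j : Fin d) : Ideal R :=
  Ideal.span ((fun i => a i ^ N i) '' {i | i ≠ j})

theorem aux_nil {R : Type*} [CommRing R] [IsNoetherianRing R] [IsLocalRing R] (d : ℕ)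
    (hdim : ringKrullDim R = (d : WithBot ℕ∞)) (a : Fin d → R)
    (ha : IsSystemOfParameters R R a) (N : Fin d → ℕ) (hN : ∀ i, 0 < N i) (j : Fin d) (m : ℕ) :
    a j ^ m ∉ auxJ a N j := by
  intro hm
  have hmax : ∀ P : Ideal R, P.IsPrime → auxJ a N j ≤ P → P = IsLocalRing.maximalIdeal R := by
    intro P hP hle
    have hmem : ∀ i, a i ∈ P := fun i => by
      by_cases hij : i = j
      · subst hij; exact hP.mem_of_pow_mem _ (hle hm)
      · exact hP.mem_of_pow_mem _ (hle (Ideal.subset_span ⟨i, hij, rfl⟩))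
    have hart := (isFiniteLength_iff_isNoetherian_isArtinian.mp ha.2.2).2
    have hle2 : (Ideal.span (Set.range a) • (⊤ : Submodule R R)) ≤ P := by
      rw [smul_eq_mul, Ideal.mul_top, Ideal.span_le]
      rintro _ ⟨i, rfl⟩
      exact hmem i
    have hart2 : IsArtinian R (R ⧸ P) :=
      isArtinian_of_surjective _ (Submodule.factor hle2) (Submodule.factor_surjective hle2)
    have hart3 : IsArtinianRing (R ⧸ P) := isArtinian_of_tower R hart2
    have hf := IsArtinianRing.isField_of_isDomain (R ⧸ P)
    exact IsLocalRing.eq_maximalIdeal (Ideal.Quotient.maximal_of_isField P hf)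
  have hmin : IsLocalRing.maximalIdeal R ∈ (auxJ a N j).minimalPrimes := by
    refine ⟨⟨inferInstance, ?_⟩, fun P hP _ => (hmax P hP.1 hP.2).ge⟩
    rw [auxJ, Ideal.span_le]
    rintro _ ⟨i, _, rfl⟩
    exact Ideal.pow_mem_of_mem _ (ha.1 i) _ (hN i)
  have h1 := Ideal.height_le_card_of_mem_minimalPrimes_span (Set.toFinite _) hmin
  have h2 : ((fun i => a i ^ N i) '' {i | i ≠ j}).ncard ≤ d - 1 := by
    refine (Set.ncard_image_le (Set.toFinite _)).trans ?_
    have : {i : Fin d | i ≠ j} = ({j} : Set (Fin d))ᶜ := by ext; simp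
    rw [this, Set.ncard_compl]
    simp
  have h3 := IsLocalRing.maximalIdeal_height_eq_ringKrullDim (R := R)
  rw [hdim] at h3
  have h4 : (IsLocalRing.maximalIdeal R).height = (d : ℕ∞) := by exact_mod_cast h3
  rw [h4] at h1
  have h5 : d ≤ ((fun i => a i ^ N i) '' {i | i ≠ j}).ncard := by exact_mod_cast h1
  have := j.pos
  omega

theorem aux_krull {R : Type*} [CommRing R] [IsNoetherianRing R] [IsLocalRing R]
    (I : Ideal R) (x : R) (h : ∀ n : ℕ, x ∈ I ⊔ IsLocalRing.maximalIdeal R ^ n) : x ∈ I := by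
  have hk := Ideal.iInf_pow_smul_eq_bot_of_isLocalRing (M := R ⧸ I) (IsLocalRing.maximalIdeal R)
    (IsLocalRing.maximalIdeal.isMaximal R).ne_top
  have : Ideal.Quotient.mk I x ∈ (⨅ i : ℕ, IsLocalRing.maximalIdeal R ^ i • ⊤ :
      Submodule R (R ⧸ I)) := by
    rw [Submodule.mem_iInf]
    intro n
    obtain ⟨y, hy, z, hz, rfl⟩ := Submodule.mem_sup.mp (h n)
    rw [map_add, Ideal.Quotient.eq_zero_iff_mem.mpr hy, zero_add]
    have h2 : Ideal.Quotient.mk I z = z • Ideal.Quotient.mk I 1 := by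
      change _ = Ideal.Quotient.mk I (z * 1)
      rw [mul_one]
    rw [h2]
    exact Submodule.smul_mem_smul hz trivial
  rw [hk, Submodule.mem_bot] at this
  exact Ideal.Quotient.eq_zero_iff_mem.mp this

theorem aux_len {R : Type*} [CommRing R] [IsNoetherianRing R] [IsLocalRing R] (rs : List R)
    (hr : RingTheory.Sequence.IsRegular R rs) : ((rs.length : ℕ∞) : WithBot ℕ∞) ≤ ringKrullDim R := by
  have h := Module.supportDim_add_length_eq_supportDim_of_isRegular rs hr
  rw [Module.supportDim_self_eq_ringKrullDim] at h
  rw [← h]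
  have hnt : Nontrivial (R ⧸ (Ideal.ofList rs • ⊤ : Submodule R R)) :=
    Submodule.Quotient.nontrivial_iff.mpr hr.top_ne_smul.symm
  have h0 : (0 : WithBot ℕ∞) ≤ Module.supportDim R (R ⧸ (Ideal.ofList rs • ⊤ : Submodule R R)) := by
    have := (Module.supportDim_ne_bot_iff_nontrivial R _).mpr hnt
    obtain ⟨v, hv⟩ := WithBot.ne_bot_iff_exists.mp this
    rw [← hv]
    exact_mod_cast (zero_le : 0 ≤ v)
  calc ((rs.length : ℕ∞) : WithBot ℕ∞) = 0 + (rs.length : WithBot ℕ∞) := by simp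
    _ ≤ _ := by gcongr

theorem aux_exists_s10 {R : Type*} [CommRing R] [IsNoetherianRing R] [IsLocalRing R] (d : ℕ)
    (hdim : ringKrullDim R = (d : WithBot ℕ∞)) (hCM : ¬ IsCohenMacaulay R R) (a : Fin d → R)
    (ha : IsSystemOfParameters R R a) :
    ∃ (j : Fin d) (N : Fin d → ℕ) (x : R), (∀ i, 0 < N i) ∧ a j * x ∈ auxJ a N j ∧
      x ∉ auxJ a N j := by
  by_contra! hcon
  apply hCM
  have hreg : RingTheory.Sequence.IsRegular R (List.ofFn a) := by
    refine ⟨⟨fun i hi => ?_⟩, ?_⟩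
    · rw [isSMulRegular_quotient_iff_mem_of_smul_mem]
      intro x hx
      have hi' : i < d := by simpa using hi
      simp only [List.getElem_ofFn, smul_eq_mul, Ideal.mul_top] at hx ⊢
      have hmemS : ∀ l : Fin d, (l : ℕ) < i → a l ∈ Ideal.ofList ((List.ofFn a).take i) := by
        intro l hl
        apply Ideal.subset_span
        change a l ∈ (List.ofFn a).take i
        rw [List.mem_take_iff_getElem]
        exact ⟨l, by simp; omega, by simp⟩
      apply aux_krull
      intro n
      let N : Fin d → ℕ := fun l => if (l : ℕ) < i then 1 else n + 1
      have h1 : x ∈ auxJ a N ⟨i, hi'⟩ := by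
        apply hcon
        · intro l; simp only [N]; split_ifs <;> omega
        · refine (?_ : Ideal.ofList ((List.ofFn a).take i) ≤ _) hx
          rw [Ideal.ofList, Ideal.span_le]
          intro y hy
          change y ∈ (List.ofFn a).take i at hy
          rw [List.mem_take_iff_getElem] at hy
          obtain ⟨l, hl, rfl⟩ := hy
          have hl' : l < i ∧ l < d := by simpa using hl
          apply Ideal.subset_span
          refine ⟨⟨l, hl'.2⟩, ?_, ?_⟩
          · simp [Fin.ext_iff]; omega
          · simp [N, hl'.1]
      refine (?_ : auxJ a N ⟨i, hi'⟩ ≤ _) h1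
      rw [auxJ, Ideal.span_le]
      rintro _ ⟨l, _, rfl⟩
      by_cases hl : (l : ℕ) < i
      · simp only [N, hl, if_true, pow_one]
        exact Submodule.mem_sup_left (hmemS l hl)
      · simp only [N, hl, if_false]
        exact Submodule.mem_sup_right (Ideal.pow_le_pow_right (Nat.le_succ n)
          (Ideal.pow_mem_pow (ha.1 l) _))
    · intro h
      rw [smul_eq_mul, Ideal.mul_top] at h
      have : Ideal.ofList (List.ofFn a) ≤ IsLocalRing.maximalIdeal R := by
        rw [Ideal.ofList, Ideal.span_le]
        intro y hy
        change y ∈ List.ofFn a at hy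
        rw [List.mem_ofFn] at hy
        obtain ⟨i, rfl⟩ := hy
        exact ha.1 i
      rw [← h] at this
      exact (IsLocalRing.maximalIdeal.isMaximal R).ne_top (top_le_iff.mp this)
  unfold IsCohenMacaulay
  rw [ha.2.1]
  have : moduleDepth R R = (d : ℕ∞) := by
    apply le_antisymm
    · apply sSup_le
      rintro _ ⟨rs, rfl, _, hrs⟩
      have := aux_len rs hrs
      rw [hdim] at this
      exact_mod_cast this
    · apply le_sSup
      refine ⟨List.ofFn a, by simp, ?_, hreg⟩
      intro r hr
      rw [List.mem_ofFn] at hr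
      obtain ⟨i, rfl⟩ := hr
      exact ha.1 i
  rw [this]

theorem aux_span {R : Type*} [CommRing R] {d : ℕ} (a : Fin d → R) (N : Fin d → ℕ) (j : Fin d)
    (m : ℕ) : Ideal.span (Set.range fun i => a i ^ (Function.update N j m) i) =
      auxJ a N j ⊔ Ideal.span {a j ^ m} := by
  rw [auxJ, ← Ideal.span_union]
  congr 1
  ext y
  constructor
  · rintro ⟨i, rfl⟩
    by_cases hij : i = j
    · subst hij; right; simp
    · left; exact ⟨i, hij, by simp [hij]⟩
  · rintro (⟨i, hij, rfl⟩ | rfl)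
    · exact ⟨i, by simp [show i ≠ j from hij]⟩
    · exact ⟨j, by simp⟩

/-- Theorem 4.2. If `R` is a non-Cohen-Macaulay Noetherian local ring of
dimension `d`, then for any system of parameters `a₁, …, a_d` there are positive integers
`n₁ ≤ N₁, …, n_d ≤ N_d` such that the `R/(a₁^{n₁}, …, a_d^{n_d})`-module
`Hom_R(R/(a₁^{n₁}, …, a_d^{n_d}), R/(a₁^{N₁}, …, a_d^{N_d}))` is decomposable and not free. -/
theorem isDecomposable_not_free_hom_higher_dim {R : Type*} [CommRing R] [IsNoetherianRing R]
    [IsLocalRing R] (d : ℕ) (hdim : ringKrullDim R = (d : WithBot ℕ∞))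
    (hCM : ¬ IsCohenMacaulay R R) (a : Fin d → R) (ha : IsSystemOfParameters R R a) :
    ∃ n N : Fin d → ℕ, (∀ i, 0 < n i) ∧ (∀ i, n i ≤ N i) ∧
      (letI := quotHomModule (Ideal.span (Set.range fun i => a i ^ n i))
          (R ⧸ Ideal.span (Set.range fun i => a i ^ N i))
       IsDecomposable (R ⧸ Ideal.span (Set.range fun i => a i ^ n i))
          ((R ⧸ Ideal.span (Set.range fun i => a i ^ n i)) →ₗ[R]
            (R ⧸ Ideal.span (Set.range fun i => a i ^ N i))) ∧
        ¬ Module.Free (R ⧸ Ideal.span (Set.range fun i => a i ^ n i))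
          ((R ⧸ Ideal.span (Set.range fun i => a i ^ n i)) →ₗ[R]
            (R ⧸ Ideal.span (Set.range fun i => a i ^ N i)))) := by
  obtain ⟨j, N, x, hN, hx, hx'⟩ := aux_exists_s10 d hdim hCM a ha
  obtain ⟨k, hk0, hk⟩ := aux_stab (auxJ a N j) (a j)
  refine ⟨Function.update N j (k + 1), Function.update N j (2 * (k + 1)), ?_, ?_, ?_⟩
  · intro i
    by_cases hij : i = j
    · subst hij; simp
    · simp [hij, hN i]
  · intro i
    by_cases hij : i = j
    · subst hij; simp only [Function.update_self]; omega
    · simp [hij]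
  · exact aux_core (auxJ a N j) (a j) (ha.1 j) (fun m => aux_nil d hdim a ha N hN j m) x hx hx' k hk0
      hk _ _ (aux_span a N j _) (aux_span a N j _)
end

section
/- Let R be a commutative Noetherian local ring with maximal ideal 𝔪, M a nonzero finitely generated faithful R-module of dimension one and depth zero, n a positive integer with 𝔪^n M ∩ Γ_𝔪(M) = (0), a a parameter of M, and c ∈ R such that c a^{n+1} is a parameter of M. Then the colon submodule satisfies (c a^{n+1} M :_M a) = c a^n M + (0 :_M a), and moreover c a^{n+1} M = c a^n M ∩ ((0 :_M a) + c a^{n+1} M). -/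
open IsLocalRing

theorem aux_pow_le {R M : Type*} [CommRing R] [IsNoetherianRing R]
    [IsLocalRing R] [AddCommGroup M] [Module R M] [Module.Finite R M]
    (hfaith : Module.annihilator R M = ⊥) (a : R) (ha : IsParameter R M a) :
    ∃ k : ℕ, maximalIdeal R ^ k ≤ Ideal.span {a} := by
  obtain ⟨-, hfl⟩ := ha
  obtain ⟨hN, hA⟩ := isFiniteLength_iff_isNoetherian_isArtinian.mp hfl
  obtain ⟨k, hk⟩ := IsArtinian.monotone_stabilizes
    (R := R) (M := M ⧸ (Ideal.span {a} • (⊤ : Submodule R M)))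
    ⟨fun j => OrderDual.toDual ((maximalIdeal R ^ j) • ⊤), fun i j hij =>
      OrderDual.toDual_le_toDual.mpr (Submodule.smul_mono_left (Ideal.pow_le_pow_right hij))⟩
  have h1 : (maximalIdeal R ^ k) • (⊤ : Submodule R (M ⧸ (Ideal.span {a} • (⊤ : Submodule R M))))
      = (maximalIdeal R ^ (k + 1)) • ⊤ := hk (k + 1) (Nat.le_succ k)
  have h2 : (maximalIdeal R ^ k) • (⊤ : Submodule R (M ⧸ (Ideal.span {a} • (⊤ : Submodule R M))))
      = ⊥ := by
    refine Submodule.eq_bot_of_le_smul_of_le_jacobson_bot (maximalIdeal R) _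
      (IsNoetherian.noetherian _) ?_ (IsLocalRing.maximalIdeal_le_jacobson _)
    rw [← mul_smul, ← pow_succ']
    exact h1.le
  have h3 : maximalIdeal R ^ k ≤
      Module.annihilator R (M ⧸ (Ideal.span {a} • (⊤ : Submodule R M))) := by
    intro r hr
    rw [Module.mem_annihilator]
    intro q
    rw [← Submodule.mem_bot R, ← h2]
    exact Submodule.smul_mem_smul hr trivial
  have h4 : Module.annihilator R (M ⧸ (Ideal.span {a} • (⊤ : Submodule R M))) ≤
      (Ideal.span {a}).radical := by
    rw [← PrimeSpectrum.zeroLocus_subset_zeroLocus_iff, ← Module.support_eq_zeroLocus,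
      Module.support_quotient, Module.support_eq_zeroLocus, hfaith]
    simp
  refine Ideal.exists_pow_le_of_le_radical_of_fg ?_ (IsNoetherian.noetherian _)
  intro r hr
  rw [← Ideal.radical_idem]
  exact ⟨k, h4 (h3 (Ideal.pow_mem_pow hr k))⟩

/-- With `M` nonzero finitely generated faithful of dimension one and depth
zero, `𝔪^n M ∩ Γ_𝔪(M) = 0`, `a` a parameter of `M` and `c a^(n+1)` a parameter of `M`, one has
`(c a^(n+1) M :_M a) = c a^n M + (0 :_M a)` and
`c a^(n+1) M = c a^n M ∩ ((0 :_M a) + c a^(n+1) M)`. -/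
theorem colon_param_decomposition_dim_one {R M : Type*} [CommRing R] [IsNoetherianRing R]
    [IsLocalRing R] [AddCommGroup M] [Module R M] [Module.Finite R M] [Nontrivial M]
    (hfaith : Module.annihilator R M = ⊥)
    (hdim : moduleDim R M = (1 : WithBot ℕ∞)) (hdepth : moduleDepth R M = 0)
    (n : ℕ) (hn : 0 < n)
    (hGamma : ((maximalIdeal R ^ n) • (⊤ : Submodule R M)) ⊓ torsionGamma (maximalIdeal R) M = ⊥)
    (a : R) (ha : IsParameter R M a)
    (c : R) (hb : IsParameter R M (c * a ^ (n + 1))) :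
    Submodule.comap (LinearMap.lsmul R M a)
        (Submodule.map (LinearMap.lsmul R M (c * a ^ (n + 1))) ⊤) =
      Submodule.map (LinearMap.lsmul R M (c * a ^ n)) ⊤ ⊔
        LinearMap.ker (LinearMap.lsmul R M a) ∧
    Submodule.map (LinearMap.lsmul R M (c * a ^ (n + 1))) ⊤ =
      Submodule.map (LinearMap.lsmul R M (c * a ^ n)) ⊤ ⊓
        (LinearMap.ker (LinearMap.lsmul R M a) ⊔
          Submodule.map (LinearMap.lsmul R M (c * a ^ (n + 1))) ⊤) := by
  constructor
  · ext m
    simp only [Submodule.mem_comap, Submodule.mem_map, Submodule.mem_sup, LinearMap.mem_ker,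
      LinearMap.lsmul_apply, Submodule.mem_top, true_and]
    constructor
    · rintro ⟨y, hy⟩
      refine ⟨_, ⟨y, rfl⟩, m - (c * a ^ n) • y, ?_, by abel⟩
      rw [smul_sub, ← hy, smul_smul, sub_eq_zero]
      congr 1
      ring
    · rintro ⟨_, ⟨y, rfl⟩, z, hz, rfl⟩
      refine ⟨y, ?_⟩
      rw [smul_add, hz, add_zero, smul_smul]
      congr 1
      ring
  · apply le_antisymm
    · refine le_inf ?_ le_sup_right
      rintro _ ⟨y, -, rfl⟩
      refine ⟨a • y, trivial, ?_⟩
      simp only [LinearMap.lsmul_apply, smul_smul]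
      congr 1
      ring
    · rintro x ⟨⟨y, -, rfl⟩, hx⟩
      obtain ⟨z, hz, _, ⟨w, -, rfl⟩, hzw⟩ := Submodule.mem_sup.mp hx
      simp only [LinearMap.mem_ker, LinearMap.lsmul_apply] at hz hzw
      have hz0 : z = 0 := by
        rw [← Submodule.mem_bot R, ← hGamma]
        refine ⟨?_, ?_⟩
        · have : z = (c * a ^ n) • (y - a • w) := by
            rw [smul_sub, ← hzw, smul_smul, mul_assoc, ← pow_succ, add_sub_cancel_right]
          rw [this]
          exact Submodule.smul_mem_smul (Ideal.mul_mem_left _ _ (Ideal.pow_mem_pow ha.1 n)) trivial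
        · obtain ⟨k, hk⟩ := aux_pow_le hfaith a ha
          refine ⟨k, fun r hr => ?_⟩
          obtain ⟨s, rfl⟩ := Ideal.mem_span_singleton'.mp (hk hr)
          rw [mul_smul, hz, smul_zero]
      refine ⟨w, trivial, ?_⟩
      simp only [LinearMap.lsmul_apply]
      rw [← hzw, hz0, zero_add]
end
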